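/- arXiv:1207.6672 — 2 statements merged into one kernel-verified Lean document; each statement's English description precedes it below -/
import Mathlib

section
/- Suppose (λ_n, u_n), with u_n ≢ 0 for each n, is a sequence of solutions of the perturbed half-quasilinear problem −(φ_p(u'))' = λ a(x) φ_p(u) + α(x) φ_p(u⁺) + β(x) φ_p(u⁻) + g(x,u,λ) on (0,1), u(0) = u(1) = 0, converging to (λ, 0) in ℝ × E, where g is continuous with |g(x,u,λ)/φ_p(u)| → 0 as |u| → 0 uniformly in x ∈ (0,1) and for λ in bounded intervals. Then λ = λ_k^ν for some k ∈ ℕ and ν ∈ {+,−}; that is, the only possible bifurcation points of this problem are the points (λ_k^ν, 0). -/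
open Set Filter Topology

/-- `φ_p(s) = |s|^{p-2} s`. -/
noncomputable def phip (p s : ℝ) : ℝ := |s| ^ (p - 2) * s

/-- membership in the space `E = {u ∈ C¹[0,1] : u 0 = u 1 = 0}`. -/
def MemE (u : ℝ → ℝ) : Prop := ContDiff ℝ 1 u ∧ u 0 = 0 ∧ u 1 = 0

/-- `u` is nontrivial on `[0,1]`. -/
def Nontriv (u : ℝ → ℝ) : Prop := ∃ x ∈ Set.Icc (0:ℝ) 1, u x ≠ 0

/-- `u ∈ S_k^ν` (ν = 1 or -1): u ∈ E, exactly k-1 interior zeros in (0,1), all zeros of u in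
[0,1] simple, and ν·u positive near 0. -/
def MemS (k : ℕ) (ν : ℝ) (u : ℝ → ℝ) : Prop :=
  MemE u ∧
  {x ∈ Ioo (0:ℝ) 1 | u x = 0}.Finite ∧
  {x ∈ Ioo (0:ℝ) 1 | u x = 0}.ncard = k - 1 ∧
  (∀ x ∈ Icc (0:ℝ) 1, u x = 0 → deriv u x ≠ 0) ∧
  ∃ δ > 0, ∀ x ∈ Ioo (0:ℝ) δ, 0 < ν * u x

/-- the `C¹` norm `‖u‖ = max_{[0,1]} |u| + max_{[0,1]} |u'|` of `E`. -/
noncomputable def normE (u : ℝ → ℝ) : ℝ :=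
  (⨆ x : Icc (0:ℝ) 1, |u x|) + (⨆ x : Icc (0:ℝ) 1, |deriv u x|)

/-- `u` solves `-(φ_p(u'))' = λ a φ_p(u) + α φ_p(u⁺) + β φ_p(u⁻)` on (0,1), u(0)=u(1)=0. -/
def IsHalfSol (p : ℝ) (a α β : ℝ → ℝ) (lam : ℝ) (u : ℝ → ℝ) : Prop :=
  MemE u ∧ ∀ x ∈ Set.Ioo (0:ℝ) 1,
    HasDerivAt (fun y => phip p (deriv u y))
      (-(lam * a x * phip p (u x) + α x * phip p (max (u x) 0)
         + β x * phip p (-min (u x) 0))) x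

/-- `u` solves the perturbed problem
`-(φ_p(u'))' = λ a φ_p(u) + α φ_p(u⁺) + β φ_p(u⁻) + g(x,u,λ)` on (0,1), u(0)=u(1)=0. -/
def IsPertSol (p : ℝ) (a α β : ℝ → ℝ) (g : ℝ → ℝ → ℝ → ℝ) (lam : ℝ) (u : ℝ → ℝ) : Prop :=
  MemE u ∧ ∀ x ∈ Set.Ioo (0:ℝ) 1,
    HasDerivAt (fun y => phip p (deriv u y))
      (-(lam * a x * phip p (u x) + α x * phip p (max (u x) 0)
         + β x * phip p (-min (u x) 0) + g x (u x) lam)) x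

lemma phip_zero (p : ℝ) : phip p 0 = 0 := by simp [phip]

lemma phip_of_nonneg {p s : ℝ} (hp : 1 < p) (hs : 0 ≤ s) : phip p s = s ^ (p - 1) := by
  rcases hs.eq_or_lt with rfl | hs
  · rw [phip_zero, Real.zero_rpow (by linarith)]
  · rw [phip, abs_of_pos hs, ← Real.rpow_add_one hs.ne']
    ring_nf

lemma phip_neg (p s : ℝ) : phip p (-s) = -phip p s := by simp [phip]

lemma abs_phip {p : ℝ} (hp : 1 < p) (s : ℝ) : |phip p s| = |s| ^ (p - 1) := by
  rw [← phip_of_nonneg hp (abs_nonneg s), phip, phip, abs_mul, abs_abs,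
    abs_of_nonneg (Real.rpow_nonneg (abs_nonneg s) _)]

lemma continuous_phip {p : ℝ} (hp : 1 < p) : Continuous (phip p) := by
  have h : phip p = fun s => (max s 0) ^ (p - 1) - (max (-s) 0) ^ (p - 1) := by
    funext s
    have h0 : (0 : ℝ) ^ (p - 1) = 0 := Real.zero_rpow (by linarith)
    rcases le_total 0 s with hs | hs
    · rw [max_eq_left hs, max_eq_right (by linarith), h0, phip_of_nonneg hp hs, sub_zero]
    · rw [max_eq_right hs, max_eq_left (by linarith), h0, ← phip_of_nonneg hp (by linarith),
        phip_neg]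
      ring
  rw [h]
  have hq : 0 ≤ p - 1 := by linarith
  exact ((continuous_id.max continuous_const).rpow_const fun _ => Or.inr hq).sub
    ((continuous_neg.max continuous_const).rpow_const fun _ => Or.inr hq)

lemma phip_mul {p c : ℝ} (hc : 0 < c) (s : ℝ) : phip p (c * s) = c ^ (p - 1) * phip p s := by
  rw [phip, phip, abs_mul, abs_of_pos hc, Real.mul_rpow hc.le (abs_nonneg s),
    show p - 1 = p - 2 + 1 by ring, Real.rpow_add_one hc.ne']
  ring

lemma one_lt_conjExponent {p : ℝ} (hp : 1 < p) : 1 < p / (p - 1) := by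
  rw [lt_div_iff₀ (by linarith)]
  linarith

lemma phip_conj_phip {p : ℝ} (hp : 1 < p) (s : ℝ) : phip (p / (p - 1)) (phip p s) = s := by
  have key : ∀ s : ℝ, 0 ≤ s → phip (p / (p - 1)) (phip p s) = s := by
    intro s hs
    have hp' : p - 1 ≠ 0 := by linarith
    rw [phip_of_nonneg hp hs,
      phip_of_nonneg (one_lt_conjExponent hp) (Real.rpow_nonneg hs _), ← Real.rpow_mul hs,
      show (p - 1) * (p / (p - 1) - 1) = 1 by field_simp; ring, Real.rpow_one]
  rcases le_total 0 s with hs | hs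
  · exact key s hs
  · have := key (-s) (by linarith)
    rw [phip_neg, phip_neg] at this
    linarith

/-- Mean value inequality with the derivative bounded in the open interval only. -/
lemma abs_sub_le_of_hasDerivAt_uIoo {w f : ℝ → ℝ} {M x y : ℝ} (hw : Continuous w)
    (hd : ∀ t ∈ uIoo x y, HasDerivAt w (f t) t) (hb : ∀ t ∈ uIoo x y, |f t| ≤ M) :
    |w x - w y| ≤ M * |x - y| := by
  have key : ∀ x y : ℝ, x < y → (∀ t ∈ Ioo x y, HasDerivAt w (f t) t) →
      (∀ t ∈ Ioo x y, |f t| ≤ M) → |w y - w x| ≤ M * |y - x| := by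
    intro x y hxy hd hb
    obtain ⟨c, hc, hce⟩ := exists_hasDerivAt_eq_slope w f hxy hw.continuousOn hd
    have hb' := hb c hc
    rw [hce, abs_div, div_le_iff₀ (abs_pos.2 (by linarith))] at hb'
    exact hb'
  rcases lt_trichotomy x y with h | rfl | h
  · rw [uIoo_of_lt h] at hd hb
    rw [abs_sub_comm, abs_sub_comm x]
    exact key x y h hd hb
  · simp
  · rw [uIoo_of_gt h] at hd hb
    exact key y x h hd hb

lemma uIoo_subset_Ioo_zero_one {x y : ℝ} (hx : x ∈ Icc (0 : ℝ) 1) (hy : y ∈ Icc (0 : ℝ) 1) :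
    uIoo x y ⊆ Ioo 0 1 := fun _ ht =>
  ⟨(le_min hx.1 hy.1).trans_lt ht.1, ht.2.trans_le (max_le hx.2 hy.2)⟩

/-- A solution of `|(φ_p(v'))'| ≤ M |v|^{p-1}` with vanishing Cauchy data at `x₀` vanishes on the
part of `[0,1]` at distance at most `h` from `x₀`, where `h` depends only on `M`. -/
lemma eq_zero_near_of_cauchy_zero {p M h : ℝ} (hp : 1 < p) (hM : 0 ≤ M) (h0 : 0 < h) (h1 : h ≤ 1)
    (hMh : M * h < 1) {v f : ℝ → ℝ} (hv : ContDiff ℝ 1 v)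
    (hd : ∀ x ∈ Ioo (0 : ℝ) 1, HasDerivAt (fun y => phip p (deriv v y)) (f x) x)
    (hf : ∀ x ∈ Ioo (0 : ℝ) 1, |f x| ≤ M * |v x| ^ (p - 1))
    {x₀ : ℝ} (hx₀ : x₀ ∈ Icc (0 : ℝ) 1) (hv₀ : v x₀ = 0) (hv₀' : deriv v x₀ = 0)
    {x : ℝ} (hx : x ∈ Icc (0 : ℝ) 1) (hxx₀ : |x - x₀| ≤ h) : v x = 0 ∧ deriv v x = 0 := by
  obtain ⟨hvd, hvc⟩ := contDiff_one_iff_deriv.1 hv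
  set J : Set ℝ := Icc 0 1 ∩ Icc (x₀ - h) (x₀ + h) with hJ
  have hJc : IsCompact J := isCompact_Icc.inter_right isClosed_Icc
  have hJo : J.OrdConnected := ordConnected_Icc.inter ordConnected_Icc
  have hx₀J : x₀ ∈ J := ⟨hx₀, by constructor <;> linarith⟩
  have hxJ : x ∈ J := ⟨hx, by constructor <;> linarith [abs_le.1 hxx₀]⟩
  have hJh : ∀ y ∈ J, |y - x₀| ≤ h := fun y hy =>
    abs_le.2 ⟨by linarith [hy.2.1], by linarith [hy.2.2]⟩
  have hsub : ∀ y ∈ J, ∀ t ∈ uIoo y x₀, t ∈ J := fun y hy t ht =>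
    hJo.uIcc_subset hy hx₀J (uIoo_subset_uIcc_self ht)
  obtain ⟨z, hz, hzmax⟩ := hJc.exists_isMaxOn ⟨x₀, hx₀J⟩ hvc.abs.continuousOn
  set m := |deriv v z| with hm
  have hm0 : 0 ≤ m := abs_nonneg _
  have hvm' : ∀ y ∈ J, |deriv v y| ≤ m := fun y hy => hzmax hy
  have hvm : ∀ y ∈ J, |v y| ≤ m := by
    intro y hy
    have := abs_sub_le_of_hasDerivAt_uIoo hv.continuous
      (fun t _ => (hvd t).hasDerivAt) (fun t ht => hvm' t (hsub y hy t ht))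
    rw [hv₀, sub_zero] at this
    nlinarith [hJh y hy]
  have hmp : 0 ≤ m ^ (p - 1) := Real.rpow_nonneg hm0 _
  have hmain : m ^ (p - 1) ≤ M * m ^ (p - 1) * h := by
    have := abs_sub_le_of_hasDerivAt_uIoo (M := M * m ^ (p - 1)) (x := z) (y := x₀)
      ((continuous_phip hp).comp hvc)
      (fun t ht => hd t (uIoo_subset_Ioo_zero_one hz.1 hx₀ ht))
      (fun t ht => (hf t (uIoo_subset_Ioo_zero_one hz.1 hx₀ ht)).trans
        (mul_le_mul_of_nonneg_left (Real.rpow_le_rpow (abs_nonneg _) (hvm t (hsub z hz t ht))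
          (by linarith)) hM))
    simp only [Function.comp, hv₀', phip_zero, sub_zero, abs_phip hp] at this
    exact this.trans (mul_le_mul_of_nonneg_left (hJh z hz) (mul_nonneg hM hmp))
  have hmz : m = 0 := by
    have h2 : m ^ (p - 1) = 0 := by nlinarith
    exact ((Real.rpow_eq_zero_iff_of_nonneg hm0).1 h2).1
  exact ⟨abs_nonpos_iff.1 (hmz ▸ hvm x hxJ), abs_nonpos_iff.1 (hmz ▸ hvm' x hxJ)⟩

/-- Uniqueness for the Cauchy problem with zero data. -/
lemma eq_zero_of_cauchy_zero {p M : ℝ} (hp : 1 < p) (hM : 0 ≤ M)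
    {v f : ℝ → ℝ} (hv : ContDiff ℝ 1 v)
    (hd : ∀ x ∈ Ioo (0 : ℝ) 1, HasDerivAt (fun y => phip p (deriv v y)) (f x) x)
    (hf : ∀ x ∈ Ioo (0 : ℝ) 1, |f x| ≤ M * |v x| ^ (p - 1))
    {x₀ : ℝ} (hx₀ : x₀ ∈ Icc (0 : ℝ) 1) (hv₀ : v x₀ = 0) (hv₀' : deriv v x₀ = 0) :
    ∀ x ∈ Icc (0 : ℝ) 1, v x = 0 ∧ deriv v x = 0 := by
  obtain ⟨hvd, hvc⟩ := contDiff_one_iff_deriv.1 hv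
  have hpos : 0 < 1 / (M + 1) := by positivity
  have hle : 1 / (M + 1) ≤ 1 := by
    rw [div_le_one (by linarith)]
    linarith
  have hlt : M * (1 / (M + 1)) < 1 := by
    rw [mul_one_div, div_lt_one (by linarith)]
    linarith
  let Z : Set (Icc (0 : ℝ) 1) := {x | v x = 0 ∧ deriv v x = 0}
  have hZ : IsClopen Z := by
    constructor
    · exact (isClosed_eq (hv.continuous.comp continuous_subtype_val) continuous_const).inter
        (isClosed_eq (hvc.comp continuous_subtype_val) continuous_const)
    · refine Metric.isOpen_iff.2 fun y hy => ⟨1 / (M + 1), hpos, fun x hx => ?_⟩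
      exact eq_zero_near_of_cauchy_zero hp hM hpos hle hlt hv hd hf y.2 hy.1 hy.2 x.2
        (Metric.mem_ball.1 hx).le
  have hu := hZ.eq_univ ⟨⟨x₀, hx₀⟩, hv₀, hv₀'⟩
  intro x hx
  have hxZ : (⟨x, hx⟩ : Icc (0 : ℝ) 1) ∈ Z := hu ▸ mem_univ _
  exact hxZ

/-- A function of `E` all of whose zeros in `[0,1]` are simple belongs to some `S_k^ν`. -/
lemma exists_memS_of_simple_zeros {v : ℝ → ℝ} (hv : MemE v)
    (hs : ∀ x ∈ Icc (0 : ℝ) 1, v x = 0 → deriv v x ≠ 0) :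
    ∃ k : ℕ, 1 ≤ k ∧ ∃ ν : ℝ, (ν = 1 ∨ ν = -1) ∧ MemS k ν v := by
  have hvd : Differentiable ℝ v := hv.1.differentiable one_ne_zero
  have hfin : {x ∈ Ioo (0 : ℝ) 1 | v x = 0}.Finite := by
    by_contra hinf
    obtain ⟨x, hx, hacc⟩ := Set.Infinite.exists_accPt_of_subset_isCompact hinf
      (isCompact_Icc (a := (0 : ℝ)) (b := 1)) fun x hx => Ioo_subset_Icc_self hx.1
    rw [accPt_iff_frequently] at hacc
    have hx0 : v x = 0 := by
      have hcl : IsClosed {y | v y = 0} := isClosed_eq hv.1.continuous continuous_const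
      exact hcl.mem_of_frequently_of_tendsto (hacc.mono fun y hy => hy.2.2) tendsto_id
    have hne := (hvd x).hasDerivAt.eventually_ne (c := 0) (hs x hx hx0)
    rw [eventually_nhdsWithin_iff] at hne
    obtain ⟨y, hy, hy'⟩ := (hacc.and_eventually hne).exists
    exact hy' hy.1 hy.2.2
  have hsign : ∀ ν : ℝ, 0 < ν * deriv v 0 → ∃ δ > 0, ∀ x ∈ Ioo (0 : ℝ) δ, 0 < ν * v x := by
    intro ν hν
    have hd := ((hvd 0).hasDerivAt.const_mul ν).tendsto_slope_zero_right
    simp only [zero_add, hv.2.1, mul_zero, sub_zero, smul_eq_mul] at hd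
    have hev := hd.eventually (lt_mem_nhds hν)
    rw [eventually_nhdsWithin_iff, Metric.eventually_nhds_iff] at hev
    obtain ⟨δ, hδ, hev⟩ := hev
    refine ⟨δ, hδ, fun x hx => ?_⟩
    have := hev (y := x) (by rw [Real.dist_eq, sub_zero, abs_of_pos hx.1]; exact hx.2) hx.1
    exact (mul_pos_iff_of_pos_left (inv_pos.2 hx.1)).1 this
  refine ⟨{x ∈ Ioo (0 : ℝ) 1 | v x = 0}.ncard + 1, by omega, ?_⟩
  rcases lt_or_gt_of_ne (hs 0 (by simp) hv.2.1) with h | h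
  · exact ⟨-1, Or.inr rfl, hv, hfin, by simp, hs, hsign _ (by linarith)⟩
  · exact ⟨1, Or.inl rfl, hv, hfin, by simp, hs, hsign _ (by linarith)⟩

/-- `C¹` compactness of functions vanishing at `0` with `|v'| ≤ 1` and `φ_p(v')` uniformly
Lipschitz on `[0,1]`. -/
lemma exists_subseq_tendstoUniformlyOn {p M : ℝ} (hp : 1 < p) (hM : 0 ≤ M) {v F : ℕ → ℝ → ℝ}
    (hv : ∀ n, ContDiff ℝ 1 (v n)) (hv0 : ∀ n, v n 0 = 0)
    (hv1 : ∀ n, ∀ x ∈ Icc (0 : ℝ) 1, |deriv (v n) x| ≤ 1)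
    (hd : ∀ n, ∀ x ∈ Ioo (0 : ℝ) 1, HasDerivAt (fun y => phip p (deriv (v n) y)) (F n x) x)
    (hF : ∀ n, ∀ x ∈ Ioo (0 : ℝ) 1, |F n x| ≤ M) :
    ∃ w : ℝ → ℝ, ContDiff ℝ 1 w ∧ w 0 = 0 ∧ ∃ σ : ℕ → ℕ, StrictMono σ ∧
      TendstoUniformlyOn (fun n => v (σ n)) w atTop (Icc 0 1) ∧
      TendstoUniformlyOn (fun n => deriv (v (σ n))) (deriv w) atTop (Icc 0 1) := by
  have hvd : ∀ n, Differentiable ℝ (v n) := fun n => (contDiff_one_iff_deriv.1 (hv n)).1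
  have hvc : ∀ n, Continuous (deriv (v n)) := fun n => (contDiff_one_iff_deriv.1 (hv n)).2
  let W : ℕ → BoundedContinuousFunction (Icc (0 : ℝ) 1) ℝ := fun n =>
    BoundedContinuousFunction.mkOfCompact ⟨fun x => phip p (deriv (v n) x),
      ((continuous_phip hp).comp (hvc n)).comp continuous_subtype_val⟩
  have hWa : ∀ n x, W n x = phip p (deriv (v n) x) := fun n x => rfl
  have hW1 : ∀ n x, W n x ∈ Icc (-1 : ℝ) 1 := by
    intro n x
    rw [hWa, mem_Icc, ← abs_le, abs_phip hp]
    exact Real.rpow_le_one (abs_nonneg _) (hv1 n x x.2) (by linarith)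
  have hWl : ∀ n, LipschitzWith M.toNNReal (W n) := by
    refine fun n => LipschitzWith.of_dist_le_mul fun x y => ?_
    rw [Real.coe_toNNReal _ hM]
    exact abs_sub_le_of_hasDerivAt_uIoo ((continuous_phip hp).comp (hvc n))
      (fun t ht => hd n t (uIoo_subset_Ioo_zero_one x.2 y.2 ht))
      (fun t ht => hF n t (uIoo_subset_Ioo_zero_one x.2 y.2 ht))
  have hcomp : IsCompact (closure (range W)) := by
    refine BoundedContinuousFunction.arzela_ascoli (Icc (-1) 1) isCompact_Icc _ ?_ ?_
    · rintro _ x ⟨n, rfl⟩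
      exact hW1 n x
    · refine (LipschitzWith.uniformEquicontinuous _ M.toNNReal ?_).equicontinuous
      rintro ⟨_, n, rfl⟩
      exact hWl n
  obtain ⟨W', -, σ, hσ, hlim⟩ := hcomp.tendsto_subseq fun n => subset_closure (mem_range_self n)
  have hWu : TendstoUniformly (fun n => ⇑(W (σ n))) W' atTop :=
    BoundedContinuousFunction.tendsto_iff_tendstoUniformly.1 hlim
  have hW'1 : ∀ x, W' x ∈ Icc (-1 : ℝ) 1 := fun x =>
    isClosed_Icc.mem_of_tendsto (hWu.tendsto_at x) (Eventually.of_forall fun n => hW1 _ x)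
  have hqc : Continuous (phip (p / (p - 1))) := continuous_phip (one_lt_conjExponent hp)
  have hu := UniformContinuousOn.comp_tendstoUniformly (fun n x => hW1 (σ n) x) hW'1
    (isCompact_Icc.uniformContinuousOn_of_continuous hqc.continuousOn) hWu
  simp only [hWa, phip_conj_phip hp] at hu
  set y : ℝ → ℝ := IccExtend zero_le_one fun x => phip (p / (p - 1)) (W' x) with hy
  have hyc : Continuous y := (hqc.comp W'.continuous).Icc_extend'
  have hderiv : ∀ x, HasDerivAt (fun x => ∫ t in (0 : ℝ)..x, y t) (y x) x := fun x =>
    (hyc.integral_hasStrictDerivAt 0 x).hasDerivAt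
  have hdw : deriv (fun x => ∫ t in (0 : ℝ)..x, y t) = y := funext fun x => (hderiv x).deriv
  have hyu : TendstoUniformlyOn (fun n => deriv (v (σ n))) y atTop (Icc 0 1) := by
    rw [Metric.tendstoUniformlyOn_iff]
    intro ε hε
    filter_upwards [Metric.tendstoUniformly_iff.1 hu ε hε] with n hn x hx
    rw [hy, IccExtend_of_mem _ _ hx]
    exact hn ⟨x, hx⟩
  refine ⟨fun x => ∫ t in (0 : ℝ)..x, y t, contDiff_one_iff_deriv.2
    ⟨fun x => (hderiv x).differentiableAt, by rwa [hdw]⟩, by simp, σ, hσ, ?_, by rwa [hdw]⟩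
  rw [Metric.tendstoUniformlyOn_iff] at hyu ⊢
  intro ε hε
  filter_upwards [hyu (ε / 2) (half_pos hε)] with n hn x hx
  have h := abs_sub_le_of_hasDerivAt_uIoo (M := ε / 2) (x := x) (y := 0)
    (w := fun x => (∫ t in (0 : ℝ)..x, y t) - v (σ n) x)
    (f := fun x => y x - deriv (v (σ n)) x)
    ((continuous_iff_continuousAt.2 fun x => (hderiv x).continuousAt).sub (hv _).continuous)
    (fun t _ => (hderiv t).sub (hvd _ t).hasDerivAt)
    (fun t ht => (hn t (Ioo_subset_Icc_self
      (uIoo_subset_Ioo_zero_one hx (left_mem_Icc.2 zero_le_one) ht))).le)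
  simp only [intervalIntegral.integral_same, hv0, sub_zero] at h
  rw [Real.dist_eq]
  have := abs_le.2 ⟨by linarith [hx.1], hx.2⟩
  nlinarith

/-- The principal part of the right-hand side of the half-quasilinear problem. -/
noncomputable def halfRhs (p : ℝ) (a α β : ℝ → ℝ) (lam x s : ℝ) : ℝ :=
  lam * a x * phip p s + α x * phip p (max s 0) + β x * phip p (-min s 0)

lemma halfRhs_mul {p : ℝ} {a α β : ℝ → ℝ} {c : ℝ} (hc : 0 < c) (lam x s : ℝ) :
    halfRhs p a α β lam x (c * s) = c ^ (p - 1) * halfRhs p a α β lam x s := by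
  have h1 : max (c * s) 0 = c * max s 0 := by rw [mul_max_of_nonneg _ _ hc.le, mul_zero]
  have h2 : -min (c * s) 0 = c * -min s 0 := by
    rw [mul_neg, mul_min_of_nonneg _ _ hc.le, mul_zero]
  rw [halfRhs, halfRhs, h1, h2, phip_mul hc, phip_mul hc, phip_mul hc]
  ring

lemma continuousOn_halfRhs {p : ℝ} (hp : 1 < p) {a α β : ℝ → ℝ} {S : Set ℝ}
    (ha : ContinuousOn a S) (hα : ContinuousOn α S) (hβ : ContinuousOn β S) :
    ContinuousOn (fun q : ℝ × ℝ × ℝ => halfRhs p a α β q.1 q.2.1 q.2.2)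
      (univ ×ˢ S ×ˢ univ) := by
  have hx : ContinuousOn (fun q : ℝ × ℝ × ℝ => q.2.1) (univ ×ˢ S ×ˢ univ) := by fun_prop
  have hm : MapsTo (fun q : ℝ × ℝ × ℝ => q.2.1) (univ ×ˢ S ×ˢ univ) S := fun q hq => hq.2.1
  have hφ := continuous_phip hp
  have h1 : Continuous fun q : ℝ × ℝ × ℝ => phip p q.2.2 := hφ.comp (by fun_prop)
  have h2 : Continuous fun q : ℝ × ℝ × ℝ => phip p (max q.2.2 0) := hφ.comp (by fun_prop)
  have h3 : Continuous fun q : ℝ × ℝ × ℝ => phip p (-min q.2.2 0) := hφ.comp (by fun_prop)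
  exact (((continuous_fst.continuousOn.mul (ha.comp hx hm)).mul h1.continuousOn).add
    ((hα.comp hx hm).mul h2.continuousOn)).add ((hβ.comp hx hm).mul h3.continuousOn)

lemma abs_halfRhs_le {p : ℝ} (hp : 1 < p) (a α β : ℝ → ℝ) (lam x s : ℝ) :
    |halfRhs p a α β lam x s| ≤ (|lam * a x| + |α x| + |β x|) * |s| ^ (p - 1) := by
  have h1 : |phip p (max s 0)| ≤ |s| ^ (p - 1) := by
    rw [abs_phip hp]
    refine Real.rpow_le_rpow (abs_nonneg _) ?_ (by linarith)
    rw [abs_of_nonneg (le_max_right _ _)]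
    exact max_le (le_abs_self s) (abs_nonneg s)
  have h2 : |phip p (-min s 0)| ≤ |s| ^ (p - 1) := by
    rw [abs_phip hp]
    refine Real.rpow_le_rpow (abs_nonneg _) ?_ (by linarith)
    rw [abs_neg, abs_of_nonpos (min_le_right _ _), neg_le]
    exact le_min (neg_abs_le s) (by simp)
  calc |halfRhs p a α β lam x s|
      ≤ |lam * a x| * |phip p s| + |α x| * |phip p (max s 0)|
          + |β x| * |phip p (-min s 0)| := by
        rw [← abs_mul, ← abs_mul, ← abs_mul]
        exact abs_add_three _ _ _
    _ ≤ |lam * a x| * |s| ^ (p - 1) + |α x| * |s| ^ (p - 1) + |β x| * |s| ^ (p - 1) := by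
        rw [abs_phip hp]
        gcongr
    _ = _ := by ring

/-- On `[0,1]` the principal part of the right-hand side is `O(|s|^{p-1})`. -/
lemma exists_abs_halfRhs_le {p : ℝ} (hp : 1 < p) {a α β : ℝ → ℝ}
    (ha : ContinuousOn a (Icc 0 1)) (hα : ContinuousOn α (Icc 0 1))
    (hβ : ContinuousOn β (Icc 0 1)) (C : ℝ) :
    ∃ M, 0 ≤ M ∧ ∀ lam, |lam| ≤ C → ∀ x ∈ Icc (0 : ℝ) 1, ∀ s,
      |halfRhs p a α β lam x s| ≤ M * |s| ^ (p - 1) := by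
  obtain ⟨A, hA⟩ := isCompact_Icc.exists_bound_of_continuousOn ha
  obtain ⟨B, hB⟩ := isCompact_Icc.exists_bound_of_continuousOn hα
  obtain ⟨D, hD⟩ := isCompact_Icc.exists_bound_of_continuousOn hβ
  simp only [Real.norm_eq_abs] at hA hB hD
  refine ⟨|C| * |A| + |B| + |D|, by positivity, fun lam hlam x hx s => ?_⟩
  refine (abs_halfRhs_le hp a α β lam x s).trans ?_
  rw [abs_mul]
  have h1 := (hA x hx).trans (le_abs_self A)
  have h2 := (hB x hx).trans (le_abs_self B)
  have h3 := (hD x hx).trans (le_abs_self D)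
  have h4 := hlam.trans (le_abs_self C)
  have h5 : 0 ≤ |s| ^ (p - 1) := Real.rpow_nonneg (abs_nonneg s) _
  gcongr

lemma tendstoUniformlyOn_halfRhs {p : ℝ} (hp : 1 < p) {a α β : ℝ → ℝ}
    (ha : ContinuousOn a (Icc 0 1)) (hα : ContinuousOn α (Icc 0 1))
    (hβ : ContinuousOn β (Icc 0 1)) {l : ℕ → ℝ} {lam : ℝ} (hl : Tendsto l atTop (𝓝 lam))
    {v : ℕ → ℝ → ℝ} {w : ℝ → ℝ} (hv : ∀ n, ∀ x ∈ Icc (0 : ℝ) 1, |v n x| ≤ 1)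
    (hu : TendstoUniformlyOn v w atTop (Icc 0 1)) :
    TendstoUniformlyOn (fun n x => halfRhs p a α β (l n) x (v n x))
      (fun x => halfRhs p a α β lam x (w x)) atTop (Icc 0 1) := by
  have hw : ∀ x ∈ Icc (0 : ℝ) 1, |w x| ≤ 1 := fun x hx =>
    le_of_tendsto (hu.tendsto_at hx).abs (Eventually.of_forall fun n => hv n x hx)
  have hK : IsCompact (Icc (lam - 1) (lam + 1) ×ˢ Icc (0 : ℝ) 1 ×ˢ Icc (-1 : ℝ) 1) :=
    isCompact_Icc.prod (isCompact_Icc.prod isCompact_Icc)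
  have huc := hK.uniformContinuousOn_of_continuous ((continuousOn_halfRhs hp ha hα hβ).mono
    (prod_mono (subset_univ _) (prod_mono subset_rfl (subset_univ _))))
  rw [Metric.uniformContinuousOn_iff] at huc
  rw [Metric.tendstoUniformlyOn_iff] at hu ⊢
  intro ε hε
  obtain ⟨δ, hδ, huc⟩ := huc ε hε
  have hl1 := Metric.tendsto_nhds.1 hl (min δ 1) (lt_min hδ one_pos)
  filter_upwards [hu δ hδ, hl1] with n hn hln x hx
  have hln' := abs_le.1 (hln.trans_le (min_le_right _ _)).le
  refine huc (lam, x, w x) ⟨by constructor <;> simp, hx, abs_le.1 (hw x hx)⟩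
    (l n, x, v n x) ⟨⟨by linarith [hln'.1], by linarith [hln'.2]⟩, hx, abs_le.1 (hv n x hx)⟩ ?_
  rw [Prod.dist_eq, Prod.dist_eq, dist_self]
  refine max_lt ?_ (max_lt hδ (hn x hx))
  rw [dist_comm]
  exact hln.trans_le (min_le_left _ _)

lemma abs_le_normE {u : ℝ → ℝ} (hu : ContDiff ℝ 1 u) {x : ℝ} (hx : x ∈ Icc (0 : ℝ) 1) :
    |u x| ≤ normE u ∧ |deriv u x| ≤ normE u := by
  have key : ∀ w : ℝ → ℝ, Continuous w →
      |w x| ≤ (⨆ y : Icc (0 : ℝ) 1, |w y|) ∧ 0 ≤ ⨆ y : Icc (0 : ℝ) 1, |w y| := by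
    intro w hw
    have hb : BddAbove (range fun y : Icc (0 : ℝ) 1 => |w y|) :=
      (isCompact_range (hw.abs.comp continuous_subtype_val)).bddAbove
    exact ⟨le_ciSup hb ⟨x, hx⟩, Real.iSup_nonneg fun _ => abs_nonneg _⟩
  have h1 := key u hu.continuous
  have h2 := key (deriv u) (contDiff_one_iff_deriv.1 hu).2
  exact ⟨by rw [normE]; linarith, by rw [normE]; linarith⟩

lemma normE_le {u : ℝ → ℝ} {A B : ℝ} (hA : ∀ x ∈ Icc (0 : ℝ) 1, |u x| ≤ A)
    (hB : ∀ x ∈ Icc (0 : ℝ) 1, |deriv u x| ≤ B) : normE u ≤ A + B := by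
  have : Nonempty (Icc (0 : ℝ) 1) := ⟨⟨0, by simp⟩⟩
  exact add_le_add (ciSup_le fun x => hA x x.2) (ciSup_le fun x => hB x x.2)

/-- The smallness of the perturbation, including the points where `s = 0`. -/
lemma exists_abs_perturbation_le {p : ℝ} (hp : 1 < p) {g : ℝ → ℝ → ℝ → ℝ}
    (hg : ContinuousOn (fun q : ℝ × ℝ × ℝ => g q.1 q.2.1 q.2.2)
      (Ioo (0:ℝ) 1 ×ˢ (univ : Set (ℝ × ℝ))))
    (hgo : ∀ C > (0:ℝ), ∀ ε > (0:ℝ), ∃ δ > (0:ℝ), ∀ x ∈ Ioo (0:ℝ) 1, ∀ s : ℝ,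
      0 < |s| → |s| < δ → ∀ lam : ℝ, |lam| ≤ C → |g x s lam| ≤ ε * |phip p s|)
    {C ε : ℝ} (hC : 0 < C) (hε : 0 < ε) :
    ∃ δ > (0:ℝ), ∀ x ∈ Ioo (0:ℝ) 1, ∀ s : ℝ, |s| < δ → ∀ lam : ℝ, |lam| ≤ C →
      |g x s lam| ≤ ε * |phip p s| := by
  obtain ⟨δ, hδ, h⟩ := hgo C hC ε hε
  refine ⟨δ, hδ, fun x hx s hs lam hlam => ?_⟩
  rcases eq_or_ne s 0 with rfl | hs0
  · have hc : Continuous fun s => g x s lam :=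
      hg.comp_continuous (f := fun s : ℝ => (x, s, lam)) (by fun_prop) fun s => ⟨hx, mem_univ _⟩
    have hφ := ((continuous_phip hp).abs.const_mul ε).tendsto 0
    refine le_of_tendsto_of_tendsto ((hc.abs.tendsto 0).mono_left nhdsWithin_le_nhds)
      (hφ.mono_left (nhdsWithin_le_nhds (s := {0}ᶜ))) ?_
    rw [EventuallyLE, eventually_nhdsWithin_iff]
    filter_upwards [Metric.ball_mem_nhds (0 : ℝ) hδ] with s hs hs0
    exact h x hx s (abs_pos.2 hs0) (by simpa using hs) lam hlam
  · exact h x hx s (abs_pos.2 hs0) hs lam hlam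

/-- The only possible bifurcation points of the perturbed half-quasilinear problem are the
half-eigenvalues `(λ_k^ν, 0)`: if nontrivial solutions `(λ_n, u_n)` converge to `(λ, 0)` in
`ℝ × E`, then `λ` is a half-eigenvalue, i.e. `λ = λ_k^ν` for some `k ∈ ℕ` and `ν ∈ {+,-}`. -/
theorem stmt9 (p : ℝ) (hp : 1 < p)
    (a α β : ℝ → ℝ)
    (ha : ContinuousOn a (Icc 0 1)) (hapos : ∀ x ∈ Icc (0:ℝ) 1, 0 < a x)
    (hα : ContinuousOn α (Icc 0 1)) (hβ : ContinuousOn β (Icc 0 1))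
    (g : ℝ → ℝ → ℝ → ℝ)
    (hg : ContinuousOn (fun q : ℝ × ℝ × ℝ => g q.1 q.2.1 q.2.2)
      (Ioo (0:ℝ) 1 ×ˢ (univ : Set (ℝ × ℝ))))
    (hgo : ∀ C > (0:ℝ), ∀ ε > (0:ℝ), ∃ δ > (0:ℝ), ∀ x ∈ Ioo (0:ℝ) 1, ∀ s : ℝ,
      0 < |s| → |s| < δ → ∀ lam : ℝ, |lam| ≤ C → |g x s lam| ≤ ε * |phip p s|)
    -- the sequence of nontrivial solutions converging to (λ, 0) in ℝ × E
    (lamn : ℕ → ℝ) (un : ℕ → ℝ → ℝ)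
    (hsol : ∀ n : ℕ, IsPertSol p a α β g (lamn n) (un n) ∧ Nontriv (un n))
    (lam : ℝ) (hlamn : Tendsto lamn atTop (𝓝 lam))
    (hun : Tendsto (fun n => normE (un n)) atTop (𝓝 0)) :
    ∃ k : ℕ, 1 ≤ k ∧ ∃ ν : ℝ, (ν = 1 ∨ ν = -1) ∧
      ∃ u : ℝ → ℝ, IsHalfSol p a α β lam u ∧ MemS k ν u := by
  have hdiff : ∀ n, ContDiff ℝ 1 (un n) := fun n => (hsol n).1.1.1
  have hcpos : ∀ n, 0 < normE (un n) := by
    intro n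
    obtain ⟨x, hx, hne⟩ := (hsol n).2
    exact (abs_pos.2 hne).trans_le (abs_le_normE (hdiff n) hx).1
  have hC : 0 < |lam| + 1 := by positivity
  have hlC : ∀ᶠ n in atTop, |lamn n| ≤ |lam| + 1 :=
    (hlamn.abs.eventually (gt_mem_nhds (lt_add_one |lam|))).mono fun n hn => hn.le
  have hrem : ∀ ε > (0 : ℝ), ∀ᶠ n in atTop, ∀ x ∈ Ioo (0 : ℝ) 1,
      |(normE (un n))⁻¹ ^ (p - 1) * g x (un n x) (lamn n)| ≤ ε := by
    intro ε hε
    obtain ⟨δ, hδ, hgδ⟩ := exists_abs_perturbation_le hp hg hgo hC hε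
    filter_upwards [hlC, hun.eventually (gt_mem_nhds hδ)] with n hn hnδ x hx
    have hux := (abs_le_normE (hdiff n) (Ioo_subset_Icc_self hx)).1
    have hc := Real.rpow_pos_of_pos (inv_pos.2 (hcpos n)) (p - 1)
    rw [abs_mul, abs_of_pos hc]
    calc (normE (un n))⁻¹ ^ (p - 1) * |g x (un n x) (lamn n)|
        ≤ (normE (un n))⁻¹ ^ (p - 1) * (ε * |phip p (un n x)|) :=
          mul_le_mul_of_nonneg_left (hgδ x hx _ (hux.trans_lt hnδ) _ hn) hc.le
      _ ≤ (normE (un n))⁻¹ ^ (p - 1) * (ε * normE (un n) ^ (p - 1)) := by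
          rw [abs_phip hp]
          gcongr
      _ = ε := by
          rw [mul_left_comm, ← Real.mul_rpow (inv_pos.2 (hcpos n)).le (hcpos n).le,
            inv_mul_cancel₀ (hcpos n).ne', Real.one_rpow, mul_one]
  obtain ⟨M, hM, hMb⟩ := exists_abs_halfRhs_le hp ha hα hβ (|lam| + 1)
  obtain ⟨N, hN⟩ := eventually_atTop.1 (hlC.and (hrem 1 one_pos))
  set v : ℕ → ℝ → ℝ := fun n x => (normE (un n))⁻¹ * un n x with hvdef
  set F : ℕ → ℝ → ℝ := fun n x => -(halfRhs p a α β (lamn n) x (v n x)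
    + (normE (un n))⁻¹ ^ (p - 1) * g x (un n x) (lamn n)) with hFdef
  have hvC : ∀ n, ContDiff ℝ 1 (v n) := fun n => contDiff_const.mul (hdiff n)
  have hdv : ∀ n x, deriv (v n) x = (normE (un n))⁻¹ * deriv (un n) x := fun n x =>
    deriv_const_mul _ ((hdiff n).differentiable one_ne_zero x)
  have hscale : ∀ n t, |t| ≤ normE (un n) → |(normE (un n))⁻¹ * t| ≤ 1 := by
    intro n t ht
    rw [abs_mul, abs_of_pos (inv_pos.2 (hcpos n)), inv_mul_le_iff₀ (hcpos n), mul_one]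
    exact ht
  have hv1 : ∀ n, ∀ x ∈ Icc (0 : ℝ) 1, |v n x| ≤ 1 := fun n x hx =>
    hscale n _ (abs_le_normE (hdiff n) hx).1
  have hv1' : ∀ n, ∀ x ∈ Icc (0 : ℝ) 1, |deriv (v n) x| ≤ 1 := fun n x hx =>
    (hdv n x).symm ▸ hscale n _ (abs_le_normE (hdiff n) hx).2
  have hd : ∀ n, ∀ x ∈ Ioo (0 : ℝ) 1,
      HasDerivAt (fun y => phip p (deriv (v n) y)) (F n x) x := by
    intro n x hx
    have h := ((hsol n).1.2 x hx).const_mul ((normE (un n))⁻¹ ^ (p - 1))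
    simp only [hdv, phip_mul (inv_pos.2 (hcpos n)), hFdef]
    rw [show v n x = (normE (un n))⁻¹ * un n x from rfl, halfRhs_mul (inv_pos.2 (hcpos n))]
    refine h.congr_deriv ?_
    rw [halfRhs]
    ring
  have hF : ∀ n ≥ N, ∀ x ∈ Ioo (0 : ℝ) 1, |F n x| ≤ M + 1 := by
    intro n hn x hx
    have hxI := Ioo_subset_Icc_self hx
    have h1 : |v n x| ^ (p - 1) ≤ 1 :=
      Real.rpow_le_one (abs_nonneg _) (hv1 n x hxI) (by linarith)
    have h2 := hMb (lamn n) (hN n hn).1 x hxI (v n x)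
    have h3 := (hN n hn).2 x hx
    have h4 := abs_add_le (halfRhs p a α β (lamn n) x (v n x))
      ((normE (un n))⁻¹ ^ (p - 1) * g x (un n x) (lamn n))
    rw [hFdef, abs_neg]
    nlinarith
  obtain ⟨w, hwC, hw0, σ, hσ, hσv, hσv'⟩ := exists_subseq_tendstoUniformlyOn hp
    (M := M + 1) (by linarith) (v := fun n => v (n + N)) (F := fun n => F (n + N))
    (fun n => hvC _) (fun n => by simp [hvdef, (hsol (n + N)).1.1.2.1]) (fun n => hv1' _)
    (fun n => hd _) (fun n => hF _ (Nat.le_add_left N n))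
  have hτ : Tendsto (fun n => σ n + N) atTop atTop :=
    (tendsto_add_atTop_nat N).comp hσ.tendsto_atTop
  have hw1 : w 1 = 0 := by
    refine tendsto_nhds_unique (hσv.tendsto_at (right_mem_Icc.2 zero_le_one)) ?_
    simp [hvdef, (hsol _).1.1.2.2]
  have hFu : TendstoUniformlyOn (fun n => F (σ n + N))
      (fun x => -halfRhs p a α β lam x (w x)) atTop (Ioo 0 1) := by
    have hh := tendstoUniformlyOn_halfRhs hp ha hα hβ (hlamn.comp hτ)
      (fun n => hv1 (σ n + N)) hσv
    rw [Metric.tendstoUniformlyOn_iff] at hh ⊢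
    intro ε hε
    filter_upwards [hh (ε / 2) (half_pos hε), hτ.eventually (hrem (ε / 2) (half_pos hε))]
      with n hn hnr x hx
    have h1 := abs_lt.1 (hn x (Ioo_subset_Icc_self hx))
    have h2 := abs_le.1 (hnr x hx)
    simp only [Function.comp] at h1
    rw [Real.dist_eq, abs_lt, hFdef]
    constructor <;> linarith
  have hwd : ∀ x ∈ Ioo (0 : ℝ) 1, HasDerivAt (fun y => phip p (deriv w y))
      (-halfRhs p a α β lam x (w x)) x := fun x hx =>
    hasDerivAt_of_tendstoUniformlyOn isOpen_Ioo hFu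
      (Eventually.of_forall fun n => hd (σ n + N))
      (fun y hy => ((continuous_phip hp).tendsto _).comp
        (hσv'.tendsto_at (Ioo_subset_Icc_self hy))) hx
  have hsimple : ∀ x ∈ Icc (0 : ℝ) 1, w x = 0 → deriv w x ≠ 0 := by
    intro x hx hwx hwx'
    have hzero := eq_zero_of_cauchy_zero hp hM hwC hwd
      (fun y hy => by
        rw [abs_neg]
        exact hMb lam (by linarith) y (Ioo_subset_Icc_self hy) (w y)) hx hwx hwx'
    rw [Metric.tendstoUniformlyOn_iff] at hσv hσv'
    obtain ⟨n, hn, hn'⟩ := ((hσv (1 / 3) (by norm_num)).and (hσv' (1 / 3) (by norm_num))).exists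
    have hpos := hcpos (σ n + N)
    have hunscale : ∀ t, |(normE (un (σ n + N)))⁻¹ * t| < 1 / 3 →
        |t| ≤ normE (un (σ n + N)) / 3 := by
      intro t ht
      rw [abs_mul, abs_of_pos (inv_pos.2 hpos), inv_mul_lt_iff₀ hpos] at ht
      linarith
    have hle := normE_le (u := un (σ n + N))
      (fun y hy => hunscale _ (by
        have := hn y hy
        rwa [(hzero y hy).1, dist_zero_left] at this))
      (fun y hy => hunscale _ (by
        have := hn' y hy
        rwa [(hzero y hy).2, dist_zero_left, hdv] at this))
    linarith
  have hwE : MemE w := ⟨hwC, hw0, hw1⟩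
  obtain ⟨k, hk, ν, hν, hS⟩ := exists_memS_of_simple_zeros hwE hsimple
  exact ⟨k, hk, ν, hν, w, ⟨hwE, hwd⟩, hS⟩
end

section
/- Consider the eigenvalue problem (φ_p(u'))' + α(x) φ_p(u⁺) + β(x) φ_p(u⁻) + λ r a(x) f(u) = 0 on (0,1), u(0) = u(1) = 0, where f(u) = f_0 φ_p(u) + ζ(u) with ζ continuous and ζ(u)/φ_p(u) → 0 as |u| → 0, r ≠ 0 and f_0 > 0. Then for each k ∈ ℕ and ν ∈ {+,−}, the point (λ_k^ν/(r f_0), 0) is a bifurcation point of this problem, and there exists an unbounded connected subset 𝒟_k^ν of the closure of the set of nontrivial solutions in ℝ × E with (λ_k^ν/(r f_0), 0) ∈ 𝒟_k^ν and 𝒟_k^ν ⊂ (ℝ × S_k^ν) ∪ {(λ_k^ν/(r f_0), 0)}. -/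
open Set Filter Topology

/-- the ambient space `ℝ × E`, with `E` embedded into `C[0,1] × C[0,1]` via `u ↦ (u, u')`. -/
abbrev CI := ContinuousMap (Set.Icc (0:ℝ) 1) ℝ

abbrev Xsp := ℝ × CI × CI

/-- `w` represents the element `u` of `E` (i.e. `w = (u|_{[0,1]}, u'|_{[0,1]})`). -/
def ReprE (u : ℝ → ℝ) (w : CI × CI) : Prop :=
  (∀ x : Set.Icc (0:ℝ) 1, w.1 x = u x) ∧ (∀ x : Set.Icc (0:ℝ) 1, w.2 x = deriv u x)

/-- `u` solves `(φ_p(u'))' + α φ_p(u⁺) + β φ_p(u⁻) + λ r a f(u) = 0` on (0,1), u(0)=u(1)=0,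
where `f(u) = f_0 φ_p(u) + ζ(u)`. -/
def IsSolLam (p r f0 : ℝ) (a α β : ℝ → ℝ) (ζ : ℝ → ℝ) (lam : ℝ) (u : ℝ → ℝ) : Prop :=
  MemE u ∧ ∀ x ∈ Set.Ioo (0:ℝ) 1,
    HasDerivAt (fun y => phip p (deriv u y))
      (-(α x * phip p (max (u x) 0) + β x * phip p (-min (u x) 0)
         + lam * r * a x * (f0 * phip p (u x) + ζ (u x)))) x

namespace HalfLinear

section Phip

variable {p q : ℝ}

lemma phip_zero (p : ℝ) : phip p 0 = 0 := by simp [phip]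

lemma phip_mul (p s t : ℝ) : phip p (s * t) = phip p s * phip p t := by
  simp only [phip, abs_mul]
  rw [Real.mul_rpow (abs_nonneg _) (abs_nonneg _)]
  ring

lemma phip_neg (p s : ℝ) : phip p (-s) = -phip p s := by
  simp [phip]

lemma phip_of_pos {s : ℝ} (hs : 0 < s) : phip p s = s ^ (p - 1) := by
  rw [phip, abs_of_pos hs, ← Real.rpow_add_one hs.ne']
  congr 1
  ring

lemma abs_phip (hp : 1 < p) (s : ℝ) : |phip p s| = |s| ^ (p - 1) := by
  rcases eq_or_ne s 0 with rfl | hs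
  · rw [phip_zero, abs_zero, Real.zero_rpow (by linarith)]
  · rw [phip, abs_mul, abs_of_nonneg (Real.rpow_nonneg (abs_nonneg s) _),
      ← Real.rpow_add_one (abs_ne_zero.2 hs)]
    congr 1
    ring

lemma mul_phip (hp : 1 < p) (s : ℝ) : s * phip p s = |s| ^ p := by
  rcases eq_or_ne s 0 with rfl | hs
  · rw [zero_mul, abs_zero, Real.zero_rpow (by linarith)]
  · rw [phip, mul_comm, mul_assoc, ← abs_mul_abs_self, ← mul_assoc,
      ← Real.rpow_add_one (abs_ne_zero.2 hs), ← Real.rpow_add_one (abs_ne_zero.2 hs)]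
    congr 1
    ring

lemma phip_ne_zero {s : ℝ} (hs : s ≠ 0) : phip p s ≠ 0 :=
  mul_ne_zero (Real.rpow_pos_of_pos (abs_pos.2 hs) _).ne' hs

lemma continuous_phip (hp : 1 < p) : Continuous (phip p) := by
  have h := (contDiff_norm_rpow (E := ℝ) hp).continuous_deriv le_rfl
  have h2 : deriv (fun x : ℝ => ‖x‖ ^ p) = fun x => p * phip p x := by
    funext x
    rw [(hasDerivAt_norm_rpow x hp).deriv, phip, Real.norm_eq_abs]
    ring
  rw [h2] at h
  have h3 : phip p = fun x => p⁻¹ * (p * phip p x) := by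
    funext x
    field_simp
  rw [h3]
  exact continuous_const.mul h

lemma hasDerivAt_abs_rpow' (hp : 1 < p) (x : ℝ) :
    HasDerivAt (fun x : ℝ => |x| ^ p) (p * phip p x) x := by
  simpa [phip, mul_assoc] using hasDerivAt_abs_rpow x hp

lemma hasDerivAt_phip_of_pos {s : ℝ} (hs : 0 < s) :
    HasDerivAt (phip p) ((p - 1) * s ^ (p - 2)) s := by
  have h := Real.hasDerivAt_rpow_const (x := s) (p := p - 1) (Or.inl hs.ne')
  rw [show p - 1 - 1 = p - 2 by ring] at h
  refine h.congr_of_eventuallyEq ?_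
  filter_upwards [lt_mem_nhds hs] with t ht using phip_of_pos ht

lemma phip_phip (hpq : p.HolderConjugate q) (s : ℝ) : phip p (phip q s) = s := by
  have key : ∀ s : ℝ, 0 < s → phip p (phip q s) = s := by
    intro s hs
    rw [phip_of_pos hs, phip_of_pos (by positivity), ← Real.rpow_mul hs.le]
    have : (q - 1) * (p - 1) = 1 := by
      have := hpq.mul_eq_add
      linarith
    rw [this, Real.rpow_one]
  rcases lt_trichotomy s 0 with hs | rfl | hs
  · have := key (-s) (by linarith)
    rw [phip_neg, phip_neg] at this
    linarith
  · simp [phip_zero]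
  · exact key s hs

lemma abs_phip_le (hp : 1 < p) {s t : ℝ} (h : |s| ≤ |t|) : |phip p s| ≤ |phip p t| := by
  rw [abs_phip hp, abs_phip hp]
  exact Real.rpow_le_rpow (abs_nonneg _) h (by linarith)

/-- The pointwise inequality behind Picone's identity. -/
lemma picone_pointwise (hpq : p.HolderConjugate q) (A B : ℝ) :
    p * (A * phip p B) ≤ A * phip p A + (p - 1) * (B * phip p B) := by
  have hp := hpq.lt
  have hq1 : (p - 1) * q = p := by
    have := hpq.mul_eq_add
    linarith
  have hy := Real.young_inequality A (phip p B) hpq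
  rw [abs_phip hp, ← Real.rpow_mul (abs_nonneg _), hq1] at hy
  rw [mul_phip hp, mul_phip hp]
  have h1 : p / q = p - 1 := by
    rw [div_eq_iff hpq.symm.pos.ne']
    linarith
  calc p * (A * phip p B) ≤ p * (|A| ^ p / p + |B| ^ p / q) :=
        mul_le_mul_of_nonneg_left hy hpq.pos.le
    _ = |A| ^ p + p / q * |B| ^ p := by
        have := hpq.pos.ne'
        field_simp
    _ = _ := by rw [h1]

end Phip

section Planar

/-- Two logarithms of a nonvanishing function along a connected set differ by a constant, here
applied to a global logarithm `g` and the principal branch. -/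
lemma log_increment {X : Type*} [TopologicalSpace X] {S : Set X} (hS : IsPreconnected S)
    {f g : X → ℂ} (hf : ContinuousOn f S) (hg : ContinuousOn g S) (c : ℂ) (hc : c ≠ 0)
    (hexp : ∀ x ∈ S, Complex.exp (g x) = f x) (hslit : ∀ x ∈ S, c * f x ∈ Complex.slitPlane)
    {x y : X} (hx : x ∈ S) (hy : y ∈ S) :
    g y - g x = Complex.log (c * f y) - Complex.log (c * f x) := by
  have hcont : ContinuousOn (fun z => (g z - Complex.log (c * f z)) / (2 * Real.pi * Complex.I))
      S := by
    refine (hg.sub ?_).div_const _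
    exact (continuousOn_const.mul hf).clog hslit
  have hval : ∀ z ∈ S, ∃ n : ℤ, (g z - Complex.log (c * f z)) / (2 * Real.pi * Complex.I)
      = -Complex.log c / (2 * Real.pi * Complex.I) + n := by
    intro z hz
    have h0 : c * f z ≠ 0 := Complex.slitPlane_ne_zero (hslit z hz)
    have : Complex.exp (g z + Complex.log c) = Complex.exp (Complex.log (c * f z)) := by
      rw [Complex.exp_log h0, Complex.exp_add, hexp z hz, Complex.exp_log hc, mul_comm]
    obtain ⟨n, hn⟩ := Complex.exp_eq_exp_iff_exists_int.1 this
    refine ⟨n, ?_⟩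
    have hpi : (2 * Real.pi * Complex.I : ℂ) ≠ 0 := Complex.two_pi_I_ne_zero
    field_simp
    linear_combination hn
  have hre : ContinuousOn (fun z => ((g z - Complex.log (c * f z)) / (2 * Real.pi * Complex.I)
      + Complex.log c / (2 * Real.pi * Complex.I)).re) S :=
    Complex.continuous_re.comp_continuousOn (hcont.add continuousOn_const)
  have himg := hS.image _ hre
  obtain ⟨n, hn⟩ := hval x hx
  obtain ⟨m, hm⟩ := hval y hy
  have hnm : n = m := by
    by_contra hne
    have hx' : (n : ℝ) ∈ (fun z => ((g z - Complex.log (c * f z)) / (2 * Real.pi * Complex.I)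
      + Complex.log c / (2 * Real.pi * Complex.I)).re) '' S := ⟨x, hx, by
        simp only [hn]; rw [neg_div]; simp⟩
    have hy' : (m : ℝ) ∈ (fun z => ((g z - Complex.log (c * f z)) / (2 * Real.pi * Complex.I)
      + Complex.log c / (2 * Real.pi * Complex.I)).re) '' S := ⟨y, hy, by
        simp only [hm]; rw [neg_div]; simp⟩
    have hord := himg.ordConnected
    have aux : ∀ a b : ℤ, a < b → (a : ℝ) ∈ (fun z => ((g z - Complex.log (c * f z)) /
        (2 * Real.pi * Complex.I) + Complex.log c / (2 * Real.pi * Complex.I)).re) '' S →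
        (b : ℝ) ∈ (fun z => ((g z - Complex.log (c * f z)) / (2 * Real.pi * Complex.I)
        + Complex.log c / (2 * Real.pi * Complex.I)).re) '' S → False := by
      intro a b hab ha hb
      have hab' : (a : ℝ) + 1 ≤ b := by exact_mod_cast hab
      obtain ⟨z, hz, hzv⟩ := hord.out ha hb
        (show (a : ℝ) + 1 / 2 ∈ Icc (a : ℝ) b from ⟨by linarith, by linarith⟩)
      obtain ⟨j, hj⟩ := hval z hz
      simp only [hj] at hzv
      rw [neg_div] at hzv
      simp only [neg_add_cancel_comm, Complex.intCast_re] at hzv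
      have h1 : (2 * j : ℤ) = 2 * a + 1 := by
        have : (2 * j : ℝ) = 2 * a + 1 := by linarith
        exact_mod_cast this
      omega
    rcases lt_or_gt_of_ne hne with h | h
    · exact aux _ _ h hx' hy'
    · exact aux _ _ h hy' hx'
  rw [hnm, ← hm] at hn
  have hpi : (2 * Real.pi * Complex.I : ℂ) ≠ 0 := Complex.two_pi_I_ne_zero
  rw [div_left_inj' hpi] at hn
  linear_combination -hn

/-- A planar continuation principle: a sign change of `h` on the bottom side of a rectangle cannot
be carried by a part `{m > 0}` of the zero set of `h` which is separated from the rest of the zero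
set and does not reach the three other sides. -/
lemma planar_continuation {l L S : ℝ} (hlL : l ≤ L) (hS : 0 ≤ S) {h m : ℝ × ℝ → ℝ}
    (hh : Continuous h) (hm : Continuous m) (hl : h (l, 0) < 0) (hL : 0 < h (L, 0))
    (hzero : ∀ x ∈ Icc l L, ∀ s ∈ Icc 0 S, h (x, s) = 0 → m (x, s) ≠ 0)
    (hbot : ∀ x ∈ Icc l L, h (x, 0) = 0 → 0 < m (x, 0))
    (hside : ∀ x ∈ Icc l L, ∀ s ∈ Icc 0 S, (x = l ∨ x = L ∨ s = S) → h (x, s) = 0 →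
      m (x, s) < 0) : False := by
  set c : ℝ × ℝ → ℝ × ℝ := fun z => (max l (min z.1 L), max 0 (min z.2 S)) with hc
  have hcc : Continuous c := by fun_prop
  have hcbox : ∀ z, (c z).1 ∈ Icc l L ∧ (c z).2 ∈ Icc 0 S := fun z =>
    ⟨⟨le_max_left _ _, max_le hlL (min_le_right _ _)⟩,
      ⟨le_max_left _ _, max_le hS (min_le_right _ _)⟩⟩
  have hcid : ∀ x ∈ Icc l L, ∀ s ∈ Icc 0 S, c (x, s) = (x, s) := by
    intro x hx s hs
    simp [hc, hx.1, hx.2, hs.1, hs.2]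
  set f : ℝ × ℝ → ℂ := fun z => ⟨h (c z), m (c z)⟩ with hf
  have hfc : Continuous f := by
    have : f = fun z => (h (c z) : ℂ) + (m (c z) : ℂ) * Complex.I := by
      funext z
      apply Complex.ext <;> simp [hf]
    rw [this]
    fun_prop
  have hf0 : ∀ z, f z ≠ 0 := by
    intro z hz
    have h1 : h (c z) = 0 := congrArg Complex.re hz
    have h2 : m (c z) = 0 := congrArg Complex.im hz
    exact hzero _ (hcbox z).1 _ (hcbox z).2 h1 h2
  obtain ⟨g, hg, hgf⟩ := Complex.exists_continuousOn_eqOn_exp_comp (X := ℝ × ℝ) (U := univ)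
    (g := f) (by
      have : ContractibleSpace (univ : Set (ℝ × ℝ)) := convex_univ.contractibleSpace univ_nonempty
      exact inferInstanceAs (SimplyConnectedSpace (univ : Set (ℝ × ℝ)))) isOpen_univ
    hfc.continuousOn (by rintro ⟨z, -, hz⟩; exact hf0 z hz)
  have hl0 : l ∈ Icc l L := ⟨le_rfl, hlL⟩
  have hL0 : L ∈ Icc l L := ⟨hlL, le_rfl⟩
  have h00 : (0 : ℝ) ∈ Icc 0 S := ⟨le_rfl, hS⟩
  have hSS : S ∈ Icc 0 S := ⟨hS, le_rfl⟩
  have hpl : IsPreconnected (Icc l L ×ˢ ({0} : Set ℝ)) :=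
    isPreconnected_Icc.prod isPreconnected_singleton
  have e1 := log_increment hpl hfc.continuousOn (hg.mono (subset_univ _)) (-Complex.I)
    (by simp) (fun x _ => hgf (mem_univ x)) (by
      rintro ⟨x, s⟩ ⟨hx, hs⟩
      obtain rfl : s = 0 := hs
      rw [Complex.mem_slitPlane_iff]
      by_cases hz : h (x, 0) = 0
      · left
        have := hbot x hx hz
        simpa [hf, hcid x hx 0 h00] using this
      · right
        simpa [hf, hcid x hx 0 h00] using hz)
    (x := (l, 0)) (y := (L, 0)) ⟨hl0, rfl⟩ ⟨hL0, rfl⟩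
  have hsides : IsPreconnected
      ((({l} : Set ℝ) ×ˢ Icc 0 S) ∪ (Icc l L ×ˢ ({S} : Set ℝ)) ∪ (({L} : Set ℝ) ×ˢ Icc 0 S)) := by
    refine IsPreconnected.union (L, S) (Or.inr ⟨hL0, rfl⟩) ⟨rfl, hSS⟩
      (IsPreconnected.union (l, S) ⟨rfl, hSS⟩ ⟨hl0, rfl⟩ ?_ ?_) ?_
    · exact isPreconnected_singleton.prod isPreconnected_Icc
    · exact isPreconnected_Icc.prod isPreconnected_singleton
    · exact isPreconnected_singleton.prod isPreconnected_Icc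
  have e2 := log_increment hsides hfc.continuousOn (hg.mono (subset_univ _)) Complex.I
    (by simp) (fun x _ => hgf (mem_univ x)) (by
      rintro ⟨x, s⟩ hxs
      have : x ∈ Icc l L ∧ s ∈ Icc 0 S ∧ (x = l ∨ x = L ∨ s = S) := by
        rcases hxs with (⟨hx, hs⟩ | ⟨hx, hs⟩) | ⟨hx, hs⟩
        · obtain rfl : x = l := hx
          exact ⟨hl0, hs, Or.inl rfl⟩
        · obtain rfl : s = S := hs
          exact ⟨hx, hSS, Or.inr (Or.inr rfl)⟩
        · obtain rfl : x = L := hx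
          exact ⟨hL0, hs, Or.inr (Or.inl rfl)⟩
      obtain ⟨hx, hs, hd⟩ := this
      rw [Complex.mem_slitPlane_iff]
      by_cases hz : h (x, s) = 0
      · left
        have := hside x hx s hs hd hz
        simpa [hf, hcid x hx s hs] using this
      · right
        simpa [hf, hcid x hx s hs] using hz)
    (x := (l, 0)) (y := (L, 0)) (Or.inl (Or.inl ⟨rfl, h00⟩)) (Or.inr ⟨rfl, h00⟩)
  rw [e1] at e2
  have e3 := congrArg Complex.im e2
  simp only [Complex.sub_im, Complex.log_im] at e3
  have a1 : (-Complex.I * f (L, 0)).arg < 0 := by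
    rw [Complex.arg_neg_iff]
    simpa [hf, hcid L hL0 0 h00] using hL
  have a2 : 0 ≤ (-Complex.I * f (l, 0)).arg := by
    rw [Complex.arg_nonneg_iff]
    simpa [hf, hcid l hl0 0 h00] using hl.le
  have a3 : 0 ≤ (Complex.I * f (L, 0)).arg := by
    rw [Complex.arg_nonneg_iff]
    simpa [hf, hcid L hL0 0 h00] using hL.le
  have a4 : (Complex.I * f (l, 0)).arg < 0 := by
    rw [Complex.arg_neg_iff]
    simpa [hf, hcid l hl0 0 h00] using hl
  linarith

end Planar

section Energy

variable {p q : ℝ}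

lemma abs_phip_mul_abs_phip_le (hpq : p.HolderConjugate q) (w z : ℝ) :
    |phip p w| * |phip q z| ≤ |w| ^ p + |z| ^ q := by
  rw [abs_phip hpq.lt, abs_phip hpq.symm.lt]
  have hy := Real.young_inequality_of_nonneg (a := |z| ^ (q - 1)) (b := |w| ^ (p - 1))
    (by positivity) (by positivity) hpq
  rw [← Real.rpow_mul (abs_nonneg _), ← Real.rpow_mul (abs_nonneg _),
    show (q - 1) * p = q by linarith [hpq.mul_eq_add],
    show (p - 1) * q = p by linarith [hpq.mul_eq_add]] at hy
  have h1 : |z| ^ q / p ≤ |z| ^ q := div_le_self (by positivity) hpq.lt.le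
  have h2 : |w| ^ p / q ≤ |w| ^ p := div_le_self (by positivity) hpq.symm.lt.le
  linarith

lemma energy_bounds (hpq : p.HolderConjugate q) {W Z A G : ℝ → ℝ} {C : ℝ}
    (hW : ∀ x ∈ Icc (0 : ℝ) 1, HasDerivAt W (A x) x)
    (hZ : ∀ x ∈ Icc (0 : ℝ) 1, HasDerivAt Z (-G x) x)
    (hA : ∀ x ∈ Icc (0 : ℝ) 1, |A x| ≤ |phip q (Z x)|)
    (hG : ∀ x ∈ Icc (0 : ℝ) 1, |G x| ≤ C * |phip p (W x)|) (hC : 0 ≤ C)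
    (hW0 : W 0 = 0) (hZ0 : |Z 0| = 1) {x : ℝ} (hx : x ∈ Icc (0 : ℝ) 1) :
    Real.exp (-(p + q * C)) ≤ |W x| ^ p + |Z x| ^ q ∧
      |W x| ^ p + |Z x| ^ q ≤ Real.exp (p + q * C) := by
  set c := p + q * C with hc
  have hp := hpq.lt
  have hq := hpq.symm.lt
  have hc0 : 0 ≤ c := by positivity
  set e : ℝ → ℝ := fun x => |W x| ^ p + |Z x| ^ q with he
  set e' : ℝ → ℝ := fun x => p * phip p (W x) * A x + q * phip q (Z x) * (-G x) with he'
  have hde : ∀ x ∈ Icc (0 : ℝ) 1, HasDerivAt e (e' x) x := fun x hx =>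
    ((hasDerivAt_abs_rpow' hp (W x)).comp x (hW x hx)).add
      ((hasDerivAt_abs_rpow' hq (Z x)).comp x (hZ x hx))
  have hbound : ∀ x ∈ Icc (0 : ℝ) 1, |e' x| ≤ c * e x := by
    intro x hx
    have hk := abs_phip_mul_abs_phip_le hpq (W x) (Z x)
    calc |e' x| ≤ p * (|phip p (W x)| * |A x|) + q * (|phip q (Z x)| * |G x|) := by
          refine (abs_add_le _ _).trans (le_of_eq ?_)
          rw [abs_mul, abs_mul, abs_mul, abs_mul, abs_neg, abs_of_pos hpq.pos,
            abs_of_pos hpq.symm.pos]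
          ring
      _ ≤ p * (|phip p (W x)| * |phip q (Z x)|) +
          q * (|phip q (Z x)| * (C * |phip p (W x)|)) := by
          have := hA x hx
          have := hG x hx
          have := hpq.pos
          have := hpq.symm.pos
          gcongr
      _ = c * (|phip p (W x)| * |phip q (Z x)|) := by rw [hc]; ring
      _ ≤ c * e x := mul_le_mul_of_nonneg_left hk hc0
  have he0 : e 0 = 1 := by
    simp only [he, hW0, hZ0, abs_zero, Real.one_rpow]
    rw [Real.zero_rpow hpq.pos.ne', zero_add]
  have hmono : ∀ σ : ℝ, ∀ x ∈ Icc (0 : ℝ) 1,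
      HasDerivAt (fun x => e x * Real.exp (σ * x)) ((e' x + σ * e x) * Real.exp (σ * x)) x := by
    intro σ x hx
    have h1 : HasDerivAt (fun x : ℝ => Real.exp (σ * x)) (Real.exp (σ * x) * (σ * 1)) x :=
      ((hasDerivAt_id x).const_mul σ).exp
    exact ((hde x hx).mul h1).congr_deriv (by ring)
  have h0 : (0 : ℝ) ∈ Icc (0 : ℝ) 1 := ⟨le_rfl, zero_le_one⟩
  constructor
  · have hm : MonotoneOn (fun x => e x * Real.exp (c * x)) (Icc 0 1) := by
      refine monotoneOn_of_deriv_nonneg (convex_Icc 0 1)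
        (fun x hx => (hmono c x hx).continuousAt.continuousWithinAt)
        (fun x hx => (hmono c x (interior_subset hx)).differentiableAt.differentiableWithinAt) ?_
      intro x hx
      rw [(hmono c x (interior_subset hx)).deriv]
      have := abs_le.1 (hbound x (interior_subset hx))
      exact mul_nonneg (by linarith) (Real.exp_pos _).le
    have := hm h0 hx hx.1
    simp only [he0, mul_zero, Real.exp_zero, mul_one] at this
    rw [Real.exp_neg, inv_le_iff_one_le_mul₀ (Real.exp_pos _)]
    refine this.trans (mul_le_mul_of_nonneg_left (Real.exp_le_exp.2 ?_) (by positivity))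
    nlinarith [hx.2]
  · have hm : AntitoneOn (fun x => e x * Real.exp (-c * x)) (Icc 0 1) := by
      refine antitoneOn_of_deriv_nonpos (convex_Icc 0 1)
        (fun x hx => (hmono (-c) x hx).continuousAt.continuousWithinAt)
        (fun x hx => (hmono (-c) x (interior_subset hx)).differentiableAt.differentiableWithinAt)
        ?_
      intro x hx
      rw [(hmono (-c) x (interior_subset hx)).deriv]
      have := abs_le.1 (hbound x (interior_subset hx))
      exact mul_nonpos_of_nonpos_of_nonneg (by linarith) (Real.exp_pos _).le
    have := hm h0 hx hx.1
    simp only [he0, mul_zero, Real.exp_zero, mul_one] at this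
    have h2 : Real.exp (c * x) ≤ Real.exp c := Real.exp_le_exp.2 (by nlinarith [hx.2])
    refine le_trans ?_ h2
    rw [neg_mul, Real.exp_neg, mul_inv_le_iff₀ (Real.exp_pos _), one_mul] at this
    exact this

lemma abs_le_of_rpow_le {r M w : ℝ} (hr : 1 < r) (hM : 1 ≤ M) (h : |w| ^ r ≤ M) : |w| ≤ M := by
  by_contra! hlt
  have h1 : |w| ^ (1 : ℝ) ≤ |w| ^ r :=
    Real.rpow_le_rpow_of_exponent_le (by linarith) hr.le
  rw [Real.rpow_one] at h1
  linarith

lemma sq_add_sq_lower (hpq : p.HolderConjugate q) {ε w z : ℝ} (hε : 0 < ε) (hε1 : ε ≤ 1)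
    (h : ε ≤ |w| ^ p + |z| ^ q) : (ε / 2) ^ 2 ≤ w ^ 2 + z ^ 2 := by
  by_contra! hlt
  have key : ∀ v : ℝ, v ^ 2 < (ε / 2) ^ 2 → ∀ r : ℝ, 1 < r → |v| ^ r < ε / 2 := by
    intro v hv r hr
    have hv' : |v| < ε / 2 := abs_lt_of_sq_lt_sq hv (by positivity)
    have : |v| ^ r ≤ |v| ^ (1 : ℝ) := by
      rcases eq_or_ne v 0 with rfl | h0
      · rw [abs_zero, Real.zero_rpow (by linarith), Real.zero_rpow one_ne_zero]
      · exact Real.rpow_le_rpow_of_exponent_ge (abs_pos.2 h0) (by linarith) hr.le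
    rw [Real.rpow_one] at this
    linarith
  have h1 := key w (by nlinarith [sq_nonneg z]) p hpq.lt
  have h2 := key z (by nlinarith [sq_nonneg w]) q hpq.symm.lt
  linarith

end Energy

/-- A path `(W, Z)` solving `W' = φ_q(Z)`, `Z' = -G` on `[0,1]` from `(0, ν)`, together with its
continuous polar angle `θ`. -/
structure PolarPath (q ν : ℝ) (G W Z θ : ℝ → ℝ) : Prop where
  W_deriv : ∀ x ∈ Icc (0 : ℝ) 1, HasDerivAt W (phip q (Z x)) x
  Z_deriv : ∀ x ∈ Icc (0 : ℝ) 1, HasDerivAt Z (-G x) x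
  angle_deriv : ∀ x ∈ Icc (0 : ℝ) 1,
    HasDerivAt θ ((phip q (Z x) * Z x + W x * G x) / (W x ^ 2 + Z x ^ 2)) x
  pos : ∀ x ∈ Icc (0 : ℝ) 1, 0 < W x ^ 2 + Z x ^ 2
  W_zero : W 0 = 0
  Z_zero : Z 0 = ν
  angle_zero : θ 0 = 0

namespace PolarPath

variable {p q ν : ℝ} {G W Z θ : ℝ → ℝ}

lemma polar (h : PolarPath q ν G W Z θ) {x : ℝ} (hx : x ∈ Icc (0 : ℝ) 1) :
    W x = ν / |ν| * √(W x ^ 2 + Z x ^ 2) * Real.sin (θ x) ∧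
      Z x = ν / |ν| * √(W x ^ 2 + Z x ^ 2) * Real.cos (θ x) := by
  set R : ℝ → ℝ := fun x => √(W x ^ 2 + Z x ^ 2) with hR
  have hRpos : ∀ x ∈ Icc (0 : ℝ) 1, 0 < R x := fun x hx => Real.sqrt_pos.2 (h.pos x hx)
  have hRsq : ∀ x ∈ Icc (0 : ℝ) 1, R x ^ 2 = W x ^ 2 + Z x ^ 2 := fun x hx =>
    Real.sq_sqrt (h.pos x hx).le
  have hRd : ∀ x ∈ Icc (0 : ℝ) 1,
      HasDerivAt R ((W x * phip q (Z x) - Z x * G x) / R x) x := by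
    intro x hx
    have h1 := (((h.W_deriv x hx).pow 2).add ((h.Z_deriv x hx).pow 2)).sqrt (h.pos x hx).ne'
    refine h1.congr_deriv ?_
    have := (hRpos x hx).ne'
    simp only [Pi.add_apply, Pi.pow_apply]
    change _ / (2 * R x) = _
    field_simp
    push_cast
    ring
  have hconst : ∀ f f' : ℝ → ℝ, (∀ x ∈ Icc (0 : ℝ) 1, HasDerivAt f (f' x) x) →
      (∀ x ∈ Icc (0 : ℝ) 1, f' x = 0) → ∀ x ∈ Icc (0 : ℝ) 1, f x = f 0 := by
    intro f f' hf hf' x hx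
    refine constant_of_has_deriv_right_zero
      (fun y hy => (hf y hy).continuousAt.continuousWithinAt) (fun y hy => ?_) x hx
    have := (hf y ⟨hy.1, hy.2.le⟩).hasDerivWithinAt (s := Ici y)
    rwa [hf' y ⟨hy.1, hy.2.le⟩] at this
  have hA := hconst (fun x => (W x * Real.cos (θ x) - Z x * Real.sin (θ x)) / R x) _
    (fun x hx => (((h.W_deriv x hx).mul (h.angle_deriv x hx).cos).sub
      ((h.Z_deriv x hx).mul (h.angle_deriv x hx).sin)).div (hRd x hx) (hRpos x hx).ne')
    (fun x hx => by
      have := (hRpos x hx).ne'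
      have h2 := hRsq x hx
      have h3 := (h.pos x hx).ne'
      rw [← h2]
      simp only [Pi.mul_apply, Pi.sub_apply]
      field_simp
      rw [h2]
      ring) x hx
  have hB := hconst (fun x => (W x * Real.sin (θ x) + Z x * Real.cos (θ x)) / R x) _
    (fun x hx => (((h.W_deriv x hx).mul (h.angle_deriv x hx).sin).add
      ((h.Z_deriv x hx).mul (h.angle_deriv x hx).cos)).div (hRd x hx) (hRpos x hx).ne')
    (fun x hx => by
      have := (hRpos x hx).ne'
      have h2 := hRsq x hx
      have h3 := (h.pos x hx).ne'
      rw [← h2]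
      simp only [Pi.mul_apply, Pi.add_apply]
      field_simp
      rw [h2]
      ring) x hx
  have hR0 : R 0 = |ν| := by
    simp [hR, h.W_zero, h.Z_zero, Real.sqrt_sq_eq_abs]
  simp only [h.W_zero, h.Z_zero, h.angle_zero, hR0, Real.sin_zero, Real.cos_zero] at hA hB
  have hne := (hRpos x hx).ne'
  rw [div_eq_iff hne] at hA hB
  have hsc := Real.sin_sq_add_cos_sq (θ x)
  constructor
  · change W x = ν / |ν| * R x * _
    linear_combination Real.cos (θ x) * hA + Real.sin (θ x) * hB - W x * hsc
  · change Z x = ν / |ν| * R x * _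
    linear_combination -Real.sin (θ x) * hA + Real.cos (θ x) * hB - Z x * hsc

lemma nu_ne_zero (h : PolarPath q ν G W Z θ) : ν ≠ 0 := by
  have := h.pos 0 ⟨le_rfl, zero_le_one⟩
  rw [h.W_zero, h.Z_zero] at this
  rintro rfl
  simp at this

lemma W_eq_zero_iff (h : PolarPath q ν G W Z θ) {x : ℝ} (hx : x ∈ Icc (0 : ℝ) 1) :
    W x = 0 ↔ Real.sin (θ x) = 0 := by
  rw [(h.polar hx).1]
  have h1 := (Real.sqrt_pos.2 (h.pos x hx)).ne'
  have h2 := h.nu_ne_zero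
  simp [h1, h2]

lemma Z_ne_zero (h : PolarPath q ν G W Z θ) {x : ℝ} (hx : x ∈ Icc (0 : ℝ) 1) (hW : W x = 0) :
    Z x ≠ 0 := by
  intro hZ
  have := h.pos x hx
  rw [hW, hZ] at this
  simp at this

lemma continuousOn_angle (h : PolarPath q ν G W Z θ) : ContinuousOn θ (Icc 0 1) :=
  fun x hx => (h.angle_deriv x hx).continuousAt.continuousWithinAt

lemma angle_deriv_pos (h : PolarPath q ν G W Z θ) (hq : 1 < q) {x : ℝ} (hx : x ∈ Icc (0 : ℝ) 1)
    {j : ℤ} (hj : θ x = j * Real.pi) :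
    0 < (phip q (Z x) * Z x + W x * G x) / (W x ^ 2 + Z x ^ 2) := by
  have hW : W x = 0 := by
    rw [h.W_eq_zero_iff hx, hj, Real.sin_int_mul_pi]
  refine div_pos ?_ (h.pos x hx)
  rw [hW, zero_mul, add_zero, mul_comm, mul_phip hq]
  exact Real.rpow_pos_of_pos (abs_pos.2 (h.Z_ne_zero hx hW)) _

/-- The polar angle crosses multiples of `π` only upwards. -/
lemma angle_crossing (h : PolarPath q ν G W Z θ) (hq : 1 < q) {j : ℤ} {x₀ x : ℝ}
    (hx₀ : 0 ≤ x₀) (hlt : x₀ < x) (hx : x ≤ 1) (hj : j * Real.pi ≤ θ x₀) :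
    j * Real.pi < θ x := by
  have hle : ∀ y ∈ Icc x₀ x, j * Real.pi ≤ θ y := by
    have hsub : ∀ y ∈ Icc x₀ x, y ∈ Icc (0 : ℝ) 1 := fun y hy =>
      ⟨hx₀.trans hy.1, hy.2.trans hx⟩
    intro y hy
    exact image_le_of_deriv_right_lt_deriv_boundary' (f := fun _ => j * Real.pi)
      (f' := fun _ => 0) continuousOn_const (fun _ _ => hasDerivWithinAt_const _ _ _) hj
      (h.continuousOn_angle.mono hsub)
      (fun z hz => (h.angle_deriv z (hsub z ⟨hz.1, hz.2.le⟩)).hasDerivWithinAt)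
      (fun z hz he => h.angle_deriv_pos hq (hsub z ⟨hz.1, hz.2.le⟩) he.symm) hy
  refine lt_of_le_of_ne (hle x ⟨hlt.le, le_rfl⟩) fun he => ?_
  have hx01 : x ∈ Icc (0 : ℝ) 1 := ⟨hx₀.trans hlt.le, hx⟩
  have hd := h.angle_deriv_pos hq hx01 he.symm
  have hev := (hasDerivAt_iff_tendsto_slope.1 (h.angle_deriv x hx01)).eventually
    (lt_mem_nhds hd)
  have hev2 : ∀ᶠ y in 𝓝[<] x, 0 < slope θ x y :=
    hev.filter_mono (nhdsWithin_mono _ fun y hy => ne_of_lt hy)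
  obtain ⟨y, hy1, hy2⟩ := (hev2.and (Ioo_mem_nhdsLT hlt)).exists
  rw [slope_def_field, div_pos_iff] at hy1
  have := hle y ⟨hy2.1.le, hy2.2.le⟩
  rcases hy1 with h1 | h1
  · linarith [hy2.2]
  · linarith

lemma angle_pos (h : PolarPath q ν G W Z θ) (hq : 1 < q) {x : ℝ} (hx : 0 < x) (hx1 : x ≤ 1) :
    0 < θ x := by
  simpa using h.angle_crossing hq (j := 0) le_rfl hx hx1 (by simp [h.angle_zero])

lemma zeros_ncard (h : PolarPath q ν G W Z θ) (hq : 1 < q) {m : ℕ} (hm : θ 1 = m * Real.pi) :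
    {x ∈ Ioo (0 : ℝ) 1 | W x = 0}.Finite ∧ {x ∈ Ioo (0 : ℝ) 1 | W x = 0}.ncard = m - 1 := by
  have hinj : InjOn (fun x => θ x / Real.pi) {x ∈ Ioo (0 : ℝ) 1 | W x = 0} := by
    have aux : ∀ x ∈ Ioo (0 : ℝ) 1, ∀ y ∈ Ioo (0 : ℝ) 1, W x = 0 → x < y → θ x ≠ θ y := by
      intro x hx y hy hW hxy
      rw [h.W_eq_zero_iff ⟨hx.1.le, hx.2.le⟩, Real.sin_eq_zero_iff] at hW
      obtain ⟨j, hj⟩ := hW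
      have := h.angle_crossing hq hx.1.le hxy hy.2.le hj.le
      rw [hj] at this
      exact this.ne
    intro x hx y hy hxy
    have hxy' : θ x = θ y := by
      have := Real.pi_pos.ne'
      simpa [div_left_inj' this] using hxy
    rcases lt_trichotomy x y with hlt | heq | hlt
    · exact absurd hxy' (aux x hx.1 y hy.1 hx.2 hlt)
    · exact heq
    · exact absurd hxy'.symm (aux y hy.1 x hx.1 hy.2 hlt)
  have himg : (fun x => θ x / Real.pi) '' {x ∈ Ioo (0 : ℝ) 1 | W x = 0}
      = (fun n : ℕ => (n : ℝ)) '' (Finset.Ioo 0 m : Set ℕ) := by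
    ext t
    constructor
    · rintro ⟨x, ⟨hx, hW⟩, rfl⟩
      have hx01 : x ∈ Icc (0 : ℝ) 1 := ⟨hx.1.le, hx.2.le⟩
      rw [h.W_eq_zero_iff hx01, Real.sin_eq_zero_iff] at hW
      obtain ⟨j, hj⟩ := hW
      have h1 := h.angle_pos hq hx.1 hx.2.le
      have h2 := h.angle_crossing hq hx.1.le hx.2 le_rfl hj.le
      rw [← hj] at h1
      rw [hm] at h2
      have hj0 : 0 < j := by
        have := pos_of_mul_pos_left h1 Real.pi_pos.le
        exact_mod_cast this
      have hjm : j < m := by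
        have := lt_of_mul_lt_mul_right h2 Real.pi_pos.le
        exact_mod_cast this
      lift j to ℕ using hj0.le
      refine ⟨j, by simpa using And.intro (Int.natCast_pos.1 hj0) (Int.ofNat_lt.1 hjm), ?_⟩
      simp only [← hj]
      have := Real.pi_pos.ne'
      field_simp
      simp
    · rintro ⟨n, hn, rfl⟩
      simp only [Finset.coe_Ioo, mem_Ioo] at hn
      have hmem : (n : ℝ) * Real.pi ∈ Ioo (θ 0) (θ 1) := by
        rw [h.angle_zero, hm]
        have h1 : (0 : ℝ) < n := by exact_mod_cast hn.1
        have h2 : (n : ℝ) < m := by exact_mod_cast hn.2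
        exact ⟨mul_pos h1 Real.pi_pos, mul_lt_mul_of_pos_right h2 Real.pi_pos⟩
      obtain ⟨x, hx, hxn⟩ := intermediate_value_Ioo zero_le_one h.continuousOn_angle hmem
      refine ⟨x, ⟨hx, ?_⟩, ?_⟩
      · rw [h.W_eq_zero_iff ⟨hx.1.le, hx.2.le⟩, hxn, Real.sin_nat_mul_pi]
      · simp only [hxn]
        have := Real.pi_pos.ne'
        field_simp
  constructor
  · refine Finite.of_finite_image ?_ hinj
    rw [himg]
    exact (Finset.finite_toSet _).image _
  · rw [← hinj.ncard_image, himg, ncard_image_of_injective _ Nat.cast_injective,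
      ncard_coe_finset, Nat.card_Ioo, Nat.sub_zero]

lemma exists_pos_near_zero (h : PolarPath q ν G W Z θ) (hq : 1 < q) :
    ∃ δ > 0, ∀ x ∈ Ioo (0 : ℝ) δ, 0 < ν * W x := by
  have hcont := (h.angle_deriv 0 ⟨le_rfl, zero_le_one⟩).continuousAt
  have hev : ∀ᶠ x in 𝓝 (0 : ℝ), θ x < Real.pi :=
    hcont.eventually (gt_mem_nhds (by rw [h.angle_zero]; exact Real.pi_pos))
  obtain ⟨δ, hδ, hb⟩ := Metric.eventually_nhds_iff.1 hev
  refine ⟨min δ 1, by positivity, fun x hx => ?_⟩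
  have hx1 : x < 1 := hx.2.trans_le (min_le_right _ _)
  have hx01 : x ∈ Icc (0 : ℝ) 1 := ⟨hx.1.le, hx1.le⟩
  have hs : 0 < Real.sin (θ x) := Real.sin_pos_of_pos_of_lt_pi (h.angle_pos hq hx.1 hx1.le)
    (hb (by rw [Real.dist_eq, sub_zero, abs_of_pos hx.1]; exact hx.2.trans_le (min_le_left _ _)))
  rw [(h.polar hx01).1]
  have h1 := Real.sqrt_pos.2 (h.pos x hx01)
  have h2 := h.nu_ne_zero
  have h3 : 0 < ν * (ν / |ν|) := by
    rw [← mul_div_assoc, ← abs_mul_abs_self]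
    have := abs_pos.2 h2
    positivity
  calc 0 < ν * (ν / |ν|) * √(W x ^ 2 + Z x ^ 2) * Real.sin (θ x) := by positivity
    _ = _ := by ring

end PolarPath

section Comparison

variable {p q : ℝ}

/-- The right-hand side of the half-linear equation. -/
noncomputable def halfRhs (p : ℝ) (a α β : ℝ → ℝ) (μ x w : ℝ) : ℝ :=
  μ * a x * phip p w + α x * phip p (max w 0) + β x * phip p (-min w 0)

/-- The coefficient seen by solutions of sign `w`. -/
lemma exists_halfRhs_eq (p : ℝ) (a α β : ℝ → ℝ) (x : ℝ) {w₁ w₂ : ℝ} (h : 0 < w₁ * w₂) :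
    ∃ c : ℝ, ∀ μ, halfRhs p a α β μ x w₁ = (μ * a x + c) * phip p w₁ ∧
      halfRhs p a α β μ x w₂ = (μ * a x + c) * phip p w₂ := by
  rcases pos_and_pos_or_neg_and_neg_of_mul_pos h with ⟨h1, h2⟩ | ⟨h1, h2⟩
  · refine ⟨α x, fun μ => ⟨?_, ?_⟩⟩
    · rw [halfRhs, max_eq_left h1.le, min_eq_right h1.le, neg_zero, phip_zero]
      ring
    · rw [halfRhs, max_eq_left h2.le, min_eq_right h2.le, neg_zero, phip_zero]
      ring
  · refine ⟨-β x, fun μ => ⟨?_, ?_⟩⟩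
    · rw [halfRhs, max_eq_right h1.le, min_eq_left h1.le, phip_neg, phip_zero]
      ring
    · rw [halfRhs, max_eq_right h2.le, min_eq_left h2.le, phip_neg, phip_zero]
      ring

lemma exists_tendsto_div {W₁ W₂ : ℝ → ℝ} {d₁ d₂ c : ℝ} {S : Set ℝ} (hS : S ⊆ {c}ᶜ)
    (h₁ : HasDerivAt W₁ d₁ c) (h₂ : HasDerivAt W₂ d₂ c) (hc : W₁ c = 0)
    (h : W₂ c = 0 → d₂ ≠ 0) : ∃ l, Tendsto (fun x => W₁ x / W₂ x) (𝓝[S] c) (𝓝 l) := by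
  by_cases h0 : W₂ c = 0
  · refine ⟨d₁ / d₂, ?_⟩
    have := ((hasDerivAt_iff_tendsto_slope.1 h₁).div (hasDerivAt_iff_tendsto_slope.1 h₂)
      (h h0)).mono_left (nhdsWithin_mono c hS)
    refine this.congr' ?_
    filter_upwards [self_mem_nhdsWithin] with x hx
    have hxc : x - c ≠ 0 := sub_ne_zero.2 (hS hx)
    simp only [Pi.div_apply, slope_def_field, hc, h0, sub_zero]
    field_simp
  · exact ⟨W₁ c / W₂ c, ((h₁.continuousAt.div h₂.continuousAt h0).tendsto).mono_left
      nhdsWithin_le_nhds⟩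

/-- Sturm-type comparison through Picone's identity. -/
lemma picone_comparison (hpq : p.HolderConjugate q) {a α β : ℝ → ℝ} {μ₁ μ₂ c d : ℝ}
    {W₁ Z₁ W₂ Z₂ : ℝ → ℝ} (hμ : μ₁ < μ₂) (hcd : c < d) (ha : ∀ x ∈ Ioo c d, 0 < a x)
    (hW₁ : ∀ x ∈ Icc c d, HasDerivAt W₁ (phip q (Z₁ x)) x)
    (hZ₁ : ∀ x ∈ Icc c d, HasDerivAt Z₁ (-halfRhs p a α β μ₁ x (W₁ x)) x)
    (hW₂ : ∀ x ∈ Icc c d, HasDerivAt W₂ (phip q (Z₂ x)) x)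
    (hZ₂ : ∀ x ∈ Icc c d, HasDerivAt Z₂ (-halfRhs p a α β μ₂ x (W₂ x)) x)
    (hc : W₁ c = 0) (hd : W₁ d = 0) (hc₂ : W₂ c = 0 → Z₂ c ≠ 0) (hd₂ : W₂ d = 0 → Z₂ d ≠ 0)
    (hsign : ∀ x ∈ Ioo c d, 0 < W₁ x * W₂ x) : False := by
  have hp := hpq.lt
  set P : ℝ → ℝ := fun x => W₁ x * (Z₁ x - phip p (W₁ x / W₂ x) * Z₂ x) with hP
  have hderiv : ∀ x ∈ Ioo c d, ∃ P', 0 < P' ∧ HasDerivAt P P' x := by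
    intro x hx
    have hx' : x ∈ Icc c d := Ioo_subset_Icc_self hx
    have hne := hsign x hx
    have h1 : W₁ x ≠ 0 := left_ne_zero_of_mul hne.ne'
    have h2 : W₂ x ≠ 0 := right_ne_zero_of_mul hne.ne'
    have ht : 0 < W₁ x / W₂ x := by
      have : W₁ x / W₂ x = W₁ x * W₂ x / (W₂ x) ^ 2 := by field_simp
      rw [this]
      positivity
    obtain ⟨e, he⟩ := exists_halfRhs_eq p a α β x hne
    have hφ : HasDerivAt (fun x => phip p (W₁ x / W₂ x)) ((p - 1) * (W₁ x / W₂ x) ^ (p - 2) *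
        ((phip q (Z₁ x) * W₂ x - W₁ x * phip q (Z₂ x)) / W₂ x ^ 2)) x :=
      HasDerivAt.comp (h₂ := phip p) (h := fun x => W₁ x / W₂ x) x (hasDerivAt_phip_of_pos ht)
        ((hW₁ x hx').div (hW₂ x hx') h2)
    refine ⟨_, ?_, (hW₁ x hx').mul ((hZ₁ x hx').sub (hφ.mul (hZ₂ x hx')))⟩
    rw [(he μ₁).1, (he μ₂).2]
    set t := W₁ x / W₂ x with htd
    set A := phip q (Z₁ x) with hA
    set B := t * phip q (Z₂ x) with hB
    have hZA : Z₁ x = phip p A := (phip_phip hpq _).symm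
    have hZB : phip p t * Z₂ x = phip p B := by
      rw [hB, phip_mul, phip_phip hpq]
    have hWt : W₁ x = t * W₂ x := by rw [htd]; field_simp
    have hWp : phip p (W₁ x) = phip p t * phip p (W₂ x) := by rw [← phip_mul, ← hWt]
    have hpt : t ^ (p - 2) * t = phip p t := by
      rw [phip, abs_of_pos ht]
    have hpic := picone_pointwise hpq A B
    have hpos : 0 < (μ₂ - μ₁) * a x * (W₁ x * phip p (W₁ x)) := by
      rw [mul_phip hp]
      have := ha x hx
      have := sub_pos.2 hμ
      have := abs_pos.2 h1
      positivity
    have hquot : W₁ x * ((A * W₂ x - W₁ x * phip q (Z₂ x)) / W₂ x ^ 2) = t * (A - B) := by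
      rw [hB, hWt]
      field_simp
    have hfin : A * (Z₁ x - phip p t * Z₂ x) + W₁ x * (-((μ₁ * a x + e) * phip p (W₁ x)) -
        ((p - 1) * t ^ (p - 2) * ((A * W₂ x - W₁ x * phip q (Z₂ x)) / W₂ x ^ 2) * Z₂ x +
          phip p t * -((μ₂ * a x + e) * phip p (W₂ x)))) =
        (A * phip p A + (p - 1) * (B * phip p B) - p * (A * phip p B)) +
          (μ₂ - μ₁) * a x * (W₁ x * phip p (W₁ x)) := by
      have e1 : W₁ x * ((p - 1) * t ^ (p - 2) *
          ((A * W₂ x - W₁ x * phip q (Z₂ x)) / W₂ x ^ 2) * Z₂ x) =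
          (p - 1) * (A - B) * phip p B := by
        rw [← hZB, ← hpt]
        linear_combination (p - 1) * t ^ (p - 2) * Z₂ x * hquot
      rw [hZB, hZA]
      linear_combination -e1 - (μ₂ * a x + e) * W₁ x * hWp
    rw [hfin]
    linarith
  have hmono : StrictMonoOn P (Ioo c d) := by
    refine strictMonoOn_of_deriv_pos (convex_Ioo c d) (fun x hx => ?_) (fun x hx => ?_)
    · obtain ⟨P', -, h⟩ := hderiv x hx
      exact h.continuousAt.continuousWithinAt
    · rw [interior_Ioo] at hx
      obtain ⟨P', h0, h⟩ := hderiv x hx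
      rwa [h.deriv]
  have hlim : ∀ (y : ℝ) (S : Set ℝ), y ∈ Icc c d → S ⊆ {y}ᶜ → W₁ y = 0 →
      (W₂ y = 0 → Z₂ y ≠ 0) → Tendsto P (𝓝[S] y) (𝓝 0) := by
    intro y S hy hS h1 h2
    obtain ⟨l, hl⟩ := exists_tendsto_div hS (hW₁ y hy) (hW₂ y hy) h1
      (fun h0 => phip_ne_zero (h2 h0))
    have e1 := (hW₁ y hy).continuousAt.tendsto.mono_left (nhdsWithin_le_nhds (s := S))
    have e2 := (hZ₁ y hy).continuousAt.tendsto.mono_left (nhdsWithin_le_nhds (s := S))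
    have e3 := (hZ₂ y hy).continuousAt.tendsto.mono_left (nhdsWithin_le_nhds (s := S))
    have := e1.mul (e2.sub ((((continuous_phip hp).tendsto l).comp hl).mul e3))
    rwa [h1, zero_mul] at this
  have hlc := hlim c (Ioi c) ⟨le_rfl, hcd.le⟩ (fun x hx => ne_of_gt hx) hc hc₂
  have hld := hlim d (Iio d) ⟨hcd.le, le_rfl⟩ (fun x hx => ne_of_lt hx) hd hd₂
  obtain ⟨x₁, hx₁⟩ := exists_between hcd
  obtain ⟨x₂, hx₂⟩ := exists_between hx₁.2
  have hm1 : x₁ ∈ Ioo c d := hx₁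
  have hm2 : x₂ ∈ Ioo c d := ⟨hx₁.1.trans hx₂.1, hx₂.2⟩
  have h1 : 0 ≤ P x₁ := by
    refine le_of_tendsto hlc ?_
    filter_upwards [Ioo_mem_nhdsGT hx₁.1] with y hy
    exact (hmono ⟨hy.1, hy.2.trans hx₁.2⟩ hm1 hy.2).le
  have h2 : P x₂ ≤ 0 := by
    refine ge_of_tendsto hld ?_
    filter_upwards [Ioo_mem_nhdsLT hx₂.2] with y hy
    exact (hmono hm2 ⟨hm2.1.trans hy.1, hy.2⟩ hy.1).le
  linarith [hmono hm1 hm2 hx₂.1]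

lemma sin_mul_sin_pos {s t : ℝ} {j : ℤ} (hs : s ∈ Ioo (j * Real.pi) ((j + 1) * Real.pi))
    (ht : t ∈ Ioo (j * Real.pi) ((j + 1) * Real.pi)) : 0 < Real.sin s * Real.sin t := by
  have h1 := Real.sin_pos_of_pos_of_lt_pi (x := s - j * Real.pi) (by linarith [hs.1])
    (by linarith [hs.2])
  have h2 := Real.sin_pos_of_pos_of_lt_pi (x := t - j * Real.pi) (by linarith [ht.1])
    (by linarith [ht.2])
  rw [Real.sin_sub_int_mul_pi] at h1 h2
  have h3 := mul_pos h1 h2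
  have h4 : ((-1 : ℝ) ^ j) * ((-1 : ℝ) ^ j) = 1 := by
    rw [← mul_zpow]
    simp
  calc 0 < _ := h3
    _ = ((-1 : ℝ) ^ j * (-1 : ℝ) ^ j) * (Real.sin s * Real.sin t) := by ring
    _ = _ := by rw [h4, one_mul]

/-- Strict monotonicity of the polar angle of half-linear problems in the spectral parameter,
at zeros of the solution. -/
lemma angle_comparison (hpq : p.HolderConjugate q) {a α β : ℝ → ℝ} {μ₁ μ₂ ν : ℝ}
    {W₁ Z₁ θ₁ W₂ Z₂ θ₂ : ℝ → ℝ} (hμ : μ₁ < μ₂) (ha : ∀ x ∈ Icc (0 : ℝ) 1, 0 < a x)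
    (h₁ : PolarPath q ν (fun x => halfRhs p a α β μ₁ x (W₁ x)) W₁ Z₁ θ₁)
    (h₂ : PolarPath q ν (fun x => halfRhs p a α β μ₂ x (W₂ x)) W₂ Z₂ θ₂) (j : ℕ) :
    ∀ x ∈ Icc (0 : ℝ) 1, θ₁ x = (j + 1 : ℕ) * Real.pi → (j + 1 : ℕ) * Real.pi < θ₂ x := by
  have hq := hpq.symm.lt
  induction j with
  | zero =>
    exact fun x hx hθ => step 0 x hx hθ 0 ⟨le_rfl, hx.1⟩ (by simpa using h₁.angle_zero)
      (by simp [h₂.angle_zero])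
  | succ j ih =>
    intro x hx hθ
    have hmem : ((j + 1 : ℕ) : ℝ) * Real.pi ∈ Icc (θ₁ 0) (θ₁ x) := by
      rw [h₁.angle_zero, hθ]
      refine ⟨by positivity, ?_⟩
      have := Real.pi_pos
      gcongr
      simp
    obtain ⟨c, hc, hcθ⟩ := intermediate_value_Icc hx.1
      (h₁.continuousOn_angle.mono (Icc_subset_Icc_right hx.2)) hmem
    exact step (j + 1) x hx hθ c hc hcθ (ih c ⟨hc.1, hc.2.trans hx.2⟩ hcθ).le
where
  step (n : ℕ) (d : ℝ) (hd : d ∈ Icc (0 : ℝ) 1) (hdθ : θ₁ d = (n + 1 : ℕ) * Real.pi) (c : ℝ)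
      (hc : c ∈ Icc 0 d) (hcθ : θ₁ c = n * Real.pi) (hcθ₂ : n * Real.pi ≤ θ₂ c) :
      (n + 1 : ℕ) * Real.pi < θ₂ d := by
    have hq := hpq.symm.lt
    by_contra! hcon
    have hpi := Real.pi_pos
    have hcd : c < d := by
      refine lt_of_le_of_ne hc.2 ?_
      rintro rfl
      rw [hcθ] at hdθ
      push_cast at hdθ
      linarith
    have hsub : ∀ x ∈ Icc c d, x ∈ Icc (0 : ℝ) 1 := fun x hx =>
      ⟨hc.1.trans hx.1, hx.2.trans hd.2⟩
    have hup : ∀ {G W Z θ : ℝ → ℝ}, PolarPath q ν G W Z θ → θ d ≤ (n + 1 : ℕ) * Real.pi →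
        ∀ x ∈ Ioo c d, θ x < ((n : ℤ) + 1) * Real.pi := by
      intro G W Z θ h hθ x hx
      by_contra! hcon
      have := h.angle_crossing hq (j := (n : ℤ) + 1) (hc.1.trans hx.1.le) hx.2 hd.2
        (by push_cast at hcon ⊢; exact hcon)
      push_cast at this hθ
      linarith
    have hlow : ∀ {G W Z θ : ℝ → ℝ}, PolarPath q ν G W Z θ → n * Real.pi ≤ θ c →
        ∀ x ∈ Ioo c d, (n : ℤ) * Real.pi < θ x := by
      intro G W Z θ h hθ x hx
      exact h.angle_crossing hq hc.1 hx.1 (hx.2.le.trans hd.2) (by exact_mod_cast hθ)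
    refine picone_comparison hpq hμ hcd (fun x hx => ha x (hsub x (Ioo_subset_Icc_self hx)))
      (fun x hx => h₁.W_deriv x (hsub x hx)) (fun x hx => h₁.Z_deriv x (hsub x hx))
      (fun x hx => h₂.W_deriv x (hsub x hx)) (fun x hx => h₂.Z_deriv x (hsub x hx)) ?_ ?_
      (h₂.Z_ne_zero (hsub c ⟨le_rfl, hcd.le⟩)) (h₂.Z_ne_zero hd) ?_
    · rw [h₁.W_eq_zero_iff (hsub c ⟨le_rfl, hcd.le⟩), hcθ, Real.sin_nat_mul_pi]
    · rw [h₁.W_eq_zero_iff hd, hdθ, Real.sin_nat_mul_pi]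
    · intro x hx
      have hx01 := hsub x (Ioo_subset_Icc_self hx)
      have hs := sin_mul_sin_pos (j := (n : ℤ))
        ⟨hlow h₁ hcθ.ge x hx, by exact_mod_cast hup h₁ hdθ.le x hx⟩
        ⟨hlow h₂ hcθ₂ x hx, by exact_mod_cast hup h₂ hcon x hx⟩
      rw [(h₁.polar hx01).1, (h₂.polar hx01).1]
      have e1 := Real.sqrt_pos.2 (h₁.pos x hx01)
      have e2 := Real.sqrt_pos.2 (h₂.pos x hx01)
      have e3 : 0 < (ν / |ν|) ^ 2 := by
        have := h₁.nu_ne_zero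
        positivity
      calc 0 < (ν / |ν|) ^ 2 * (√(W₁ x ^ 2 + Z₁ x ^ 2) * √(W₂ x ^ 2 + Z₂ x ^ 2)) *
            (Real.sin (θ₁ x) * Real.sin (θ₂ x)) := by positivity
        _ = _ := by ring

end Comparison

section DelayOperator

variable (ψ : C(ℝ, ℝ)) (F : C((ℝ × ℝ) × ℝ × ℝ, ℝ)) (ν : ℝ)

lemma continuous_extend_sub :
    Continuous fun z : ℝ × CI × ℝ => IccExtend zero_le_one z.2.1 (z.2.2 - z.1) :=
  ContinuousEval.continuous_eval.comp (f := fun z : ℝ × CI × ℝ =>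
    (z.2.1, projIcc (0 : ℝ) 1 zero_le_one (z.2.2 - z.1))) (by fun_prop)

/-- The first component of the delayed integral operator, as a function on `ℝ`. -/
noncomputable def pathW (δ : ℝ) (y : CI × CI) (x : ℝ) : ℝ :=
  ∫ t in (0 : ℝ)..x, ψ (IccExtend zero_le_one y.2 (t - δ))

/-- The second component of the delayed integral operator, as a function on `ℝ`. -/
noncomputable def pathZ (δ : ℝ) (v : ℝ × ℝ) (y : CI × CI) (x : ℝ) : ℝ :=
  ν - ∫ t in (0 : ℝ)..x, F (v, t, IccExtend zero_le_one y.1 (t - δ))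

lemma continuous_integrandW :
    Continuous fun z : (ℝ × (ℝ × ℝ) × CI × CI) × ℝ =>
      ψ (IccExtend zero_le_one z.1.2.2.2 (z.2 - z.1.1)) :=
  ψ.continuous.comp (continuous_extend_sub.comp (f := fun z : (ℝ × (ℝ × ℝ) × CI × CI) × ℝ =>
    (z.1.1, z.1.2.2.2, z.2)) (by fun_prop))

lemma continuous_integrandZ :
    Continuous fun z : (ℝ × (ℝ × ℝ) × CI × CI) × ℝ =>
      F (z.1.2.1, z.2, IccExtend zero_le_one z.1.2.2.1 (z.2 - z.1.1)) := by
  refine F.continuous.comp (Continuous.prodMk (by fun_prop) (Continuous.prodMk (by fun_prop) ?_))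
  exact continuous_extend_sub.comp (f := fun z : (ℝ × (ℝ × ℝ) × CI × CI) × ℝ =>
    (z.1.1, z.1.2.2.1, z.2)) (by fun_prop)

lemma continuous_pathW :
    Continuous fun z : (ℝ × (ℝ × ℝ) × CI × CI) × ℝ => pathW ψ z.1.1 z.1.2.2 z.2 :=
  intervalIntegral.continuous_parametric_intervalIntegral_of_continuous
    (f := fun (z : (ℝ × (ℝ × ℝ) × CI × CI) × ℝ) (t : ℝ) =>
      ψ (IccExtend zero_le_one z.1.2.2.2 (t - z.1.1)))
    ((continuous_integrandW ψ).comp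
      (f := fun z : ((ℝ × (ℝ × ℝ) × CI × CI) × ℝ) × ℝ => (z.1.1, z.2)) (by fun_prop))
    continuous_snd

lemma continuous_pathZ :
    Continuous fun z : (ℝ × (ℝ × ℝ) × CI × CI) × ℝ => pathZ F ν z.1.1 z.1.2.1 z.1.2.2 z.2 :=
  continuous_const.sub (intervalIntegral.continuous_parametric_intervalIntegral_of_continuous
    (f := fun (z : (ℝ × (ℝ × ℝ) × CI × CI) × ℝ) (t : ℝ) =>
      F (z.1.2.1, t, IccExtend zero_le_one z.1.2.2.1 (t - z.1.1)))
    ((continuous_integrandZ F).comp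
      (f := fun z : ((ℝ × (ℝ × ℝ) × CI × CI) × ℝ) × ℝ => (z.1.1, z.2)) (by fun_prop))
    continuous_snd)

/-- The delayed integral operator of the planar system `w' = ψ(z)`, `z' = -F(v, ·, w)` with initial
value `(0, ν)`. -/
noncomputable def delayOp (δ : ℝ) (v : ℝ × ℝ) (y : CI × CI) : CI × CI :=
  (⟨fun x => pathW ψ δ y x, (continuous_pathW ψ).comp (f := fun x : Icc (0 : ℝ) 1 =>
      (((δ, (0 : ℝ × ℝ), y), (x : ℝ)) : (ℝ × (ℝ × ℝ) × CI × CI) × ℝ)) (by fun_prop)⟩,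
    ⟨fun x => pathZ F ν δ v y x, (continuous_pathZ F ν).comp (f := fun x : Icc (0 : ℝ) 1 =>
      (((δ, v, y), (x : ℝ)) : (ℝ × (ℝ × ℝ) × CI × CI) × ℝ)) (by fun_prop)⟩)

lemma continuous_delayOp :
    Continuous fun z : ℝ × (ℝ × ℝ) × CI × CI => delayOp ψ F ν z.1 z.2.1 z.2.2 := by
  refine Continuous.prodMk ?_ ?_
  · exact ContinuousMap.continuous_of_continuous_uncurry _ ((continuous_pathW ψ).comp
      (f := fun z : (ℝ × (ℝ × ℝ) × CI × CI) × Icc (0 : ℝ) 1 => (z.1, (z.2 : ℝ))) (by fun_prop))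
  · exact ContinuousMap.continuous_of_continuous_uncurry _ ((continuous_pathZ F ν).comp
      (f := fun z : (ℝ × (ℝ × ℝ) × CI × CI) × Icc (0 : ℝ) 1 => (z.1, (z.2 : ℝ))) (by fun_prop))

lemma hasDerivAt_pathW (δ : ℝ) (y : CI × CI) (x : ℝ) :
    HasDerivAt (pathW ψ δ y) (ψ (IccExtend zero_le_one y.2 (x - δ))) x := by
  have h : Continuous fun t : ℝ => ψ (IccExtend zero_le_one y.2 (t - δ)) :=
    (continuous_integrandW ψ).comp (f := fun t : ℝ =>
      (((δ, (0 : ℝ × ℝ), y), t) : (ℝ × (ℝ × ℝ) × CI × CI) × ℝ)) (by fun_prop)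
  exact intervalIntegral.integral_hasDerivAt_right (h.intervalIntegrable _ _)
    (h.stronglyMeasurableAtFilter _ _) h.continuousAt

lemma hasDerivAt_pathZ (δ : ℝ) (v : ℝ × ℝ) (y : CI × CI) (x : ℝ) :
    HasDerivAt (pathZ F ν δ v y) (-F (v, x, IccExtend zero_le_one y.1 (x - δ))) x := by
  have h : Continuous fun t : ℝ => F (v, t, IccExtend zero_le_one y.1 (t - δ)) :=
    (continuous_integrandZ F).comp (f := fun t : ℝ =>
      (((δ, v, y), t) : (ℝ × (ℝ × ℝ) × CI × CI) × ℝ)) (by fun_prop)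
  exact (intervalIntegral.integral_hasDerivAt_right (h.intervalIntegrable _ _)
    (h.stronglyMeasurableAtFilter _ _) h.continuousAt).const_sub ν

lemma pathW_zero (δ : ℝ) (y : CI × CI) : pathW ψ δ y 0 = 0 := by simp [pathW]

lemma pathZ_zero (δ : ℝ) (v : ℝ × ℝ) (y : CI × CI) : pathZ F ν δ v y 0 = ν := by simp [pathZ]

variable {ψ F ν}

/-- The extension of an undelayed fixed point coincides with its integral representation. -/
lemma IsFixedPt.extend {v : ℝ × ℝ} {y : CI × CI} (hy : delayOp ψ F ν 0 v y = y) {x : ℝ}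
    (hx : x ∈ Icc (0 : ℝ) 1) : IccExtend zero_le_one y.1 x = pathW ψ 0 y x ∧
      IccExtend zero_le_one y.2 x = pathZ F ν 0 v y x := by
  rw [IccExtend_of_mem _ _ hx, IccExtend_of_mem _ _ hx]
  exact ⟨(DFunLike.congr_fun (congrArg Prod.fst hy) ⟨x, hx⟩).symm,
    (DFunLike.congr_fun (congrArg Prod.snd hy) ⟨x, hx⟩).symm⟩

lemma IsFixedPt.hasDerivAt {v : ℝ × ℝ} {y : CI × CI} (hy : delayOp ψ F ν 0 v y = y) {x : ℝ}
    (hx : x ∈ Icc (0 : ℝ) 1) :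
    HasDerivAt (pathW ψ 0 y) (ψ (pathZ F ν 0 v y x)) x ∧
      HasDerivAt (pathZ F ν 0 v y) (-F (v, x, pathW ψ 0 y x)) x := by
  have h1 := hasDerivAt_pathW ψ 0 y x
  have h2 := hasDerivAt_pathZ F ν 0 v y x
  rw [sub_zero] at h1 h2
  rw [(IsFixedPt.extend hy hx).2] at h1
  rw [(IsFixedPt.extend hy hx).1] at h2
  exact ⟨h1, h2⟩

lemma delayOp_congr {δ b : ℝ} (hb : 0 ≤ b) (v : ℝ × ℝ) {y y' : CI × CI}
    (h : ∀ x : Icc (0 : ℝ) 1, (x : ℝ) ≤ b → y.1 x = y'.1 x ∧ y.2 x = y'.2 x)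
    (x : Icc (0 : ℝ) 1) (hx : (x : ℝ) ≤ b + δ) :
    (delayOp ψ F ν δ v y).1 x = (delayOp ψ F ν δ v y').1 x ∧
      (delayOp ψ F ν δ v y).2 x = (delayOp ψ F ν δ v y').2 x := by
  have key : ∀ t ∈ uIcc (0 : ℝ) x,
      IccExtend zero_le_one y.1 (t - δ) = IccExtend zero_le_one y'.1 (t - δ) ∧
      IccExtend zero_le_one y.2 (t - δ) = IccExtend zero_le_one y'.2 (t - δ) := by
    intro t ht
    rw [uIcc_of_le x.2.1] at ht
    refine h (projIcc 0 1 zero_le_one (t - δ)) ?_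
    rw [coe_projIcc]
    exact max_le hb ((min_le_right _ _).trans (by linarith [ht.2]))
  constructor
  · exact intervalIntegral.integral_congr fun t ht => by
      simp only [(key t ht).2]
  · exact congrArg (ν - ·) (intervalIntegral.integral_congr fun t ht => by
      simp only [(key t ht).1])

/-- For positive delays the integral operator has a fixed point depending continuously on the
parameters. -/
lemma exists_continuous_fixedPt (ψ : C(ℝ, ℝ)) (F : C((ℝ × ℝ) × ℝ × ℝ, ℝ)) (ν : ℝ) {δ : ℝ}
    (hδ : 0 < δ) :
    ∃ Y : ℝ × ℝ → CI × CI, Continuous Y ∧ ∀ v, delayOp ψ F ν δ v (Y v) = Y v := by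
  obtain ⟨N, hN⟩ := exists_nat_ge (1 / δ)
  set y₀ : CI × CI := (0, ContinuousMap.const _ ν) with hy₀
  refine ⟨fun v => (delayOp ψ F ν δ v)^[N] y₀, ?_, fun v => ?_⟩
  · have : ∀ n : ℕ, Continuous fun v => (delayOp ψ F ν δ v)^[n] y₀ := by
      intro n
      induction n with
      | zero => exact continuous_const
      | succ n ih =>
        simp only [Function.iterate_succ_apply']
        exact (continuous_delayOp ψ F ν).comp
          (f := fun v => (δ, v, (delayOp ψ F ν δ v)^[n] y₀)) (by fun_prop)
    exact this N
  · have : ∀ n : ℕ, ∀ x : Icc (0 : ℝ) 1, (x : ℝ) ≤ n * δ →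
        ((delayOp ψ F ν δ v)^[n + 1] y₀).1 x = ((delayOp ψ F ν δ v)^[n] y₀).1 x ∧
        ((delayOp ψ F ν δ v)^[n + 1] y₀).2 x = ((delayOp ψ F ν δ v)^[n] y₀).2 x := by
      intro n
      induction n with
      | zero =>
        intro x hx
        have hx0 : (x : ℝ) = 0 := le_antisymm (by simpa using hx) x.2.1
        constructor
        · change pathW ψ δ y₀ x = 0
          rw [hx0, pathW_zero]
        · change pathZ F ν δ v y₀ x = ν
          rw [hx0, pathZ_zero]
      | succ n ih =>
        intro x hx
        rw [Function.iterate_succ_apply' _ (n + 1), Function.iterate_succ_apply' _ n]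
        rw [Function.iterate_succ_apply' _ n] at ih
        exact delayOp_congr (by positivity) v ih x (by push_cast at hx; linarith)
    rw [div_le_iff₀ hδ] at hN
    have hx : ∀ x : Icc (0 : ℝ) 1, (x : ℝ) ≤ N * δ := fun x => x.2.2.trans hN
    change delayOp ψ F ν δ v ((delayOp ψ F ν δ v)^[N] y₀) = (delayOp ψ F ν δ v)^[N] y₀
    rw [← Function.iterate_succ_apply' (delayOp ψ F ν δ v) N y₀]
    exact Prod.ext (ContinuousMap.ext fun x => (this N x (hx x)).1)
      (ContinuousMap.ext fun x => (this N x (hx x)).2)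

lemma isCompact_lipschitz (B b : ℝ) :
    IsCompact {f : CI | (∀ x, |f x| ≤ B) ∧ ∀ x y, |f x - f y| ≤ b * dist x y} := by
  refine ArzelaAscoli.isCompact_of_equicontinuous _ ?_ ?_
  · have himg : ContinuousMap.toFun '' {f : CI | (∀ x, |f x| ≤ B) ∧
        ∀ x y, |f x - f y| ≤ b * dist x y} =
        (univ.pi fun _ => Icc (-B) B) ∩ {f | ∀ x y, |f x - f y| ≤ b * dist x y} := by
      ext f
      constructor
      · rintro ⟨g, hg, rfl⟩
        exact ⟨fun x _ => abs_le.1 (hg.1 x), hg.2⟩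
      · rintro ⟨h1, h2⟩
        refine ⟨⟨f, ?_⟩, ⟨fun x => abs_le.2 (h1 x trivial), h2⟩, rfl⟩
        refine LipschitzWith.continuous (K := b.toNNReal) (LipschitzWith.of_dist_le_mul ?_)
        intro x y
        rw [Real.dist_eq]
        exact (h2 x y).trans (mul_le_mul_of_nonneg_right (Real.le_coe_toNNReal b) dist_nonneg)
    rw [himg]
    refine (isCompact_univ_pi fun _ => isCompact_Icc).inter_right ?_
    simp only [ofPred_forall]
    refine isClosed_iInter fun x => isClosed_iInter fun y => ?_
    exact isClosed_le (by fun_prop) continuous_const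
  · refine Metric.equicontinuous_of_continuity_modulus (fun t => b * t) ?_ _ ?_
    · exact (continuous_const.mul continuous_id).tendsto' _ _ (mul_zero b)
    · intro x y f
      exact f.2.2 x y

lemma abs_integral_sub_le {g : ℝ → ℝ} (hg : Continuous g) {B : ℝ}
    (hB : ∀ t ∈ Icc (0 : ℝ) 1, |g t| ≤ B) (x y : Icc (0 : ℝ) 1) :
    |(∫ t in (0 : ℝ)..x, g t) - ∫ t in (0 : ℝ)..y, g t| ≤ B * dist x y := by
  rw [intervalIntegral.integral_interval_sub_left (hg.intervalIntegrable _ _)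
    (hg.intervalIntegrable _ _)]
  rw [Subtype.dist_eq, Real.dist_eq]
  exact intervalIntegral.norm_integral_le_of_norm_le_const (f := g) (C := B) fun t ht => hB t
    ((convex_Icc (0 : ℝ) 1).ordConnected.uIcc_subset y.2 x.2 (uIoc_subset_uIcc ht))

/-- The delayed integral operators take values in a fixed compact set. -/
lemma exists_isCompact_delayOp_mem (ψ : C(ℝ, ℝ)) (F : C((ℝ × ℝ) × ℝ × ℝ, ℝ)) (ν : ℝ)
    {V : Set (ℝ × ℝ)} {B : ℝ} (hψ : ∀ z, |ψ z| ≤ B)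
    (hF : ∀ v ∈ V, ∀ t ∈ Icc (0 : ℝ) 1, ∀ w, |F (v, t, w)| ≤ B) :
    ∃ C : Set (CI × CI), IsCompact C ∧ ∀ δ, ∀ v ∈ V, ∀ y, delayOp ψ F ν δ v y ∈ C := by
  have hB : 0 ≤ B := (abs_nonneg _).trans (hψ 0)
  refine ⟨_, (isCompact_lipschitz (|ν| + B) B).prod (isCompact_lipschitz (|ν| + B) B), ?_⟩
  intro δ v hv y
  have c1 : Continuous fun t : ℝ => ψ (IccExtend zero_le_one y.2 (t - δ)) :=
    (continuous_integrandW ψ).comp (f := fun t : ℝ =>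
      (((δ, (0 : ℝ × ℝ), y), t) : (ℝ × (ℝ × ℝ) × CI × CI) × ℝ)) (by fun_prop)
  have c2 : Continuous fun t : ℝ => F (v, t, IccExtend zero_le_one y.1 (t - δ)) :=
    (continuous_integrandZ F).comp (f := fun t : ℝ =>
      (((δ, v, y), t) : (ℝ × (ℝ × ℝ) × CI × CI) × ℝ)) (by fun_prop)
  have h1 := abs_integral_sub_le c1 (fun t _ => hψ _)
  have h2 := abs_integral_sub_le c2 (fun t ht => hF v hv t ht _)
  have bound : ∀ g : ℝ → ℝ, (∀ x y : Icc (0 : ℝ) 1,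
      |(∫ t in (0 : ℝ)..x, g t) - ∫ t in (0 : ℝ)..y, g t| ≤ B * dist x y) →
      ∀ x : Icc (0 : ℝ) 1, |∫ t in (0 : ℝ)..x, g t| ≤ B := by
    intro g hg x
    have := hg x ⟨0, le_rfl, zero_le_one⟩
    rw [intervalIntegral.integral_same, sub_zero, Subtype.dist_eq, Real.dist_eq, sub_zero,
      abs_of_nonneg x.2.1] at this
    exact this.trans (mul_le_of_le_one_right hB x.2.2)
  refine ⟨⟨fun x => ?_, h1⟩, ⟨fun x => ?_, fun x y => ?_⟩⟩
  · exact (bound _ h1 x).trans (le_add_of_nonneg_left (abs_nonneg ν))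
  · exact (abs_sub _ _).trans (add_le_add_right (bound _ h2 x) _)
  · have := h2 y x
    rw [dist_comm] at this
    refine le_trans (le_of_eq ?_) this
    exact congrArg abs (sub_sub_sub_cancel_left _ _ _)

end DelayOperator

section Angle

variable {ψ : C(ℝ, ℝ)} {F : C((ℝ × ℝ) × ℝ × ℝ, ℝ)} {ν : ℝ}

/-- The integral of the angular velocity, regularised by a lower bound `c` for `w ^ 2 + z ^ 2`. -/
noncomputable def angleInt (ψ : C(ℝ, ℝ)) (F : C((ℝ × ℝ) × ℝ × ℝ, ℝ)) (c : ℝ) (v : ℝ × ℝ)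
    (y : CI × CI) (x : ℝ) : ℝ :=
  ∫ t in (0 : ℝ)..x, (ψ (IccExtend zero_le_one y.2 t) * IccExtend zero_le_one y.2 t +
    IccExtend zero_le_one y.1 t * F (v, t, IccExtend zero_le_one y.1 t)) /
      max (IccExtend zero_le_one y.1 t ^ 2 + IccExtend zero_le_one y.2 t ^ 2) c

lemma continuous_angleIntegrand {c : ℝ} (hc : 0 < c) :
    Continuous fun z : ((ℝ × ℝ) × CI × CI) × ℝ =>
      (ψ (IccExtend zero_le_one z.1.2.2 z.2) * IccExtend zero_le_one z.1.2.2 z.2 +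
        IccExtend zero_le_one z.1.2.1 z.2 * F (z.1.1, z.2, IccExtend zero_le_one z.1.2.1 z.2)) /
      max (IccExtend zero_le_one z.1.2.1 z.2 ^ 2 + IccExtend zero_le_one z.1.2.2 z.2 ^ 2) c := by
  have h1 : Continuous fun z : ((ℝ × ℝ) × CI × CI) × ℝ => IccExtend zero_le_one z.1.2.1 z.2 :=
    ContinuousEval.continuous_eval.comp (f := fun z : ((ℝ × ℝ) × CI × CI) × ℝ =>
      (z.1.2.1, projIcc (0 : ℝ) 1 zero_le_one z.2)) (by fun_prop)
  have h2 : Continuous fun z : ((ℝ × ℝ) × CI × CI) × ℝ => IccExtend zero_le_one z.1.2.2 z.2 :=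
    ContinuousEval.continuous_eval.comp (f := fun z : ((ℝ × ℝ) × CI × CI) × ℝ =>
      (z.1.2.2, projIcc (0 : ℝ) 1 zero_le_one z.2)) (by fun_prop)
  refine Continuous.div ?_ (by fun_prop) fun z => (lt_max_of_lt_right hc).ne'
  exact ((ψ.continuous.comp h2).mul h2).add (h1.mul (F.continuous.comp (by fun_prop)))

lemma continuous_angleInt {c : ℝ} (hc : 0 < c) (x : ℝ) :
    Continuous fun z : (ℝ × ℝ) × CI × CI => angleInt ψ F c z.1 z.2 x :=
  intervalIntegral.continuous_parametric_intervalIntegral_of_continuous'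
    (f := fun (z : (ℝ × ℝ) × CI × CI) (t : ℝ) =>
      (ψ (IccExtend zero_le_one z.2.2 t) * IccExtend zero_le_one z.2.2 t +
        IccExtend zero_le_one z.2.1 t * F (z.1, t, IccExtend zero_le_one z.2.1 t)) /
      max (IccExtend zero_le_one z.2.1 t ^ 2 + IccExtend zero_le_one z.2.2 t ^ 2) c)
    (continuous_angleIntegrand hc) 0 x

lemma IsFixedPt.polarPath {q c : ℝ} {v : ℝ × ℝ} {y : CI × CI}
    (hy : delayOp ψ F ν 0 v y = y) (hc : 0 < c)
    (hψ : ∀ x ∈ Icc (0 : ℝ) 1, ψ (pathZ F ν 0 v y x) = phip q (pathZ F ν 0 v y x))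
    (hlow : ∀ x ∈ Icc (0 : ℝ) 1, c ≤ pathW ψ 0 y x ^ 2 + pathZ F ν 0 v y x ^ 2) :
    PolarPath q ν (fun x => F (v, x, pathW ψ 0 y x)) (pathW ψ 0 y) (pathZ F ν 0 v y)
      (angleInt ψ F c v y) where
  W_deriv x hx := hψ x hx ▸ (IsFixedPt.hasDerivAt hy hx).1
  Z_deriv x hx := (IsFixedPt.hasDerivAt hy hx).2
  angle_deriv x hx := by
    have h := (continuous_angleIntegrand (ψ := ψ) (F := F) hc).comp
      (f := fun t : ℝ => (((v, y), t) : ((ℝ × ℝ) × CI × CI) × ℝ)) (by fun_prop)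
    have hd := intervalIntegral.integral_hasDerivAt_right (h.intervalIntegrable 0 x)
      (h.stronglyMeasurableAtFilter _ _) h.continuousAt
    refine hd.congr_deriv ?_
    simp only [Function.comp_apply]
    rw [(IsFixedPt.extend hy hx).1, (IsFixedPt.extend hy hx).2, max_eq_left (hlow x hx), hψ x hx]
  pos x hx := hc.trans_le (hlow x hx)
  W_zero := pathW_zero _ _ _
  Z_zero := pathZ_zero _ _ _ _ _
  angle_zero := by simp [angleInt]

end Angle

section Shooting

variable {p q : ℝ}

/-- Truncation of the real line to `[-M, M]`. -/
noncomputable def clampC (M : ℝ) : C(ℝ, ℝ) := ⟨fun x => max (-M) (min x M), by fun_prop⟩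

lemma clampC_of_abs_le {M x : ℝ} (h : |x| ≤ M) : clampC M x = x := by
  obtain ⟨h1, h2⟩ := abs_le.1 h
  simp [clampC, h1, h2]

lemma abs_clampC_le {M : ℝ} (hM : 0 ≤ M) (x : ℝ) : |clampC M x| ≤ |x| ∧ |clampC M x| ≤ M := by
  have h : clampC M x = max (-M) (min x M) := rfl
  rw [h]
  constructor
  · rcases le_total x M with h1 | h1
    · rw [min_eq_left h1]
      rcases le_total (-M) x with h2 | h2
      · rw [max_eq_right h2]
      · rw [max_eq_left h2, abs_neg, abs_of_nonneg hM, abs_of_nonpos (by linarith)]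
        linarith
    · rw [min_eq_right h1, max_eq_right (by linarith), abs_of_nonneg hM]
      exact h1.trans (le_abs_self x)
  · exact abs_le.2 ⟨le_max_left _ _, max_le (by linarith) (min_le_right _ _)⟩

/-- The function `φ_q` precomposed with a truncation. -/
noncomputable def shootPsi (hq : 1 < q) (κ : C(ℝ, ℝ)) : C(ℝ, ℝ) :=
  ⟨fun z => phip q (κ z), (continuous_phip hq).comp κ.continuous⟩

/-- The right-hand side of the rescaled nonlinear problem, with parameters `v = (μ, s)`. -/
noncomputable def shootRhs (p : ℝ) (a α β η : C(ℝ, ℝ)) (v : ℝ × ℝ) (t w : ℝ) : ℝ :=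
  halfRhs p a α β v.1 t w + v.1 * a t * phip p w * η (v.2 * w)

lemma continuous_shootRhs (hp : 1 < p) (a α β η : C(ℝ, ℝ)) :
    Continuous fun z : (ℝ × ℝ) × ℝ × ℝ => shootRhs p a α β η z.1 z.2.1 z.2.2 := by
  have h := continuous_phip hp
  unfold shootRhs halfRhs
  fun_prop

/-- The truncated right-hand side of the rescaled nonlinear problem. -/
noncomputable def shootF (hp : 1 < p) (a α β η κ : C(ℝ, ℝ)) : C((ℝ × ℝ) × ℝ × ℝ, ℝ) :=
  ⟨fun z => shootRhs p a α β η z.1 z.2.1 (κ z.2.2), (continuous_shootRhs hp a α β η).comp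
    (f := fun z : (ℝ × ℝ) × ℝ × ℝ => (z.1, z.2.1, κ z.2.2)) (by fun_prop)⟩

lemma abs_shootRhs_le (hp : 1 < p) {a α β η : C(ℝ, ℝ)} {A H L t : ℝ} {v : ℝ × ℝ}
    (ha : |a t| ≤ A) (hα : |α t| ≤ A) (hβ : |β t| ≤ A) (hη : ∀ s, |η s| ≤ H) (hv : |v.1| ≤ L)
    (w : ℝ) : |shootRhs p a α β η v t w| ≤ A * (L * (1 + H) + 2) * |phip p w| := by
  have hA := (abs_nonneg _).trans ha
  have hL := (abs_nonneg _).trans hv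
  have h1 : |phip p (max w 0)| ≤ |phip p w| := by
    refine abs_phip_le hp ?_
    rw [abs_of_nonneg (le_max_right w 0)]
    exact max_le (le_abs_self w) (abs_nonneg w)
  have h2 : |phip p (-min w 0)| ≤ |phip p w| := by
    refine abs_phip_le hp ?_
    rw [abs_neg, abs_of_nonpos (min_le_right w 0), neg_le]
    exact le_min (neg_abs_le w) (by simp)
  calc |shootRhs p a α β η v t w|
      ≤ |v.1| * |a t| * |phip p w| + |α t| * |phip p (max w 0)| + |β t| * |phip p (-min w 0)| +
        |v.1| * |a t| * |phip p w| * |η (v.2 * w)| := by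
        simp only [← abs_mul]
        exact (abs_add_le _ _).trans (add_le_add_left (abs_add_three _ _ _) _)
    _ ≤ L * A * |phip p w| + A * |phip p w| + A * |phip p w| + L * A * |phip p w| * H := by
        have := hη (v.2 * w)
        gcongr
    _ = _ := by ring

/-- Exponential energy bound for the rescaled problem. -/
noncomputable def shootBound (p q A H L : ℝ) : ℝ := p + q * (A * (L * (1 + H) + 2))

variable {hp : 1 < p} {hq : 1 < q} {a α β η κ : C(ℝ, ℝ)} {A H L ν : ℝ} {v : ℝ × ℝ} {y : CI × CI}

lemma shoot_energy (hpq : p.HolderConjugate q) (hκ : ∀ x, |κ x| ≤ |x|) (hν : |ν| = 1)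
    (ha : ∀ t ∈ Icc (0 : ℝ) 1, |a t| ≤ A) (hα : ∀ t ∈ Icc (0 : ℝ) 1, |α t| ≤ A)
    (hβ : ∀ t ∈ Icc (0 : ℝ) 1, |β t| ≤ A) (hη : ∀ s, |η s| ≤ H) (hv : |v.1| ≤ L)
    (hy : delayOp (shootPsi hq κ) (shootF hp a α β η κ) ν 0 v y = y) {x : ℝ}
    (hx : x ∈ Icc (0 : ℝ) 1) :
    (Real.exp (-shootBound p q A H L) / 2) ^ 2 ≤ pathW (shootPsi hq κ) 0 y x ^ 2 +
        pathZ (shootF hp a α β η κ) ν 0 v y x ^ 2 ∧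
      |pathW (shootPsi hq κ) 0 y x| ≤ Real.exp (shootBound p q A H L) ∧
      |pathZ (shootF hp a α β η κ) ν 0 v y x| ≤ Real.exp (shootBound p q A H L) := by
  have h0 : (0 : ℝ) ∈ Icc (0 : ℝ) 1 := ⟨le_rfl, zero_le_one⟩
  have hA := (abs_nonneg _).trans (ha 0 h0)
  have hL := (abs_nonneg _).trans hv
  have hH := (abs_nonneg _).trans (hη 0)
  have hC : 0 ≤ A * (L * (1 + H) + 2) := by positivity
  obtain ⟨e1, e2⟩ := energy_bounds hpq (fun x hx => (IsFixedPt.hasDerivAt hy hx).1)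
    (fun x hx => (IsFixedPt.hasDerivAt hy hx).2) (fun x _ => abs_phip_le hq (hκ _))
    (fun x hx => (abs_shootRhs_le hp (ha x hx) (hα x hx) (hβ x hx) hη hv _).trans
      (mul_le_mul_of_nonneg_left (abs_phip_le hp (hκ _)) hC)) hC
    (pathW_zero _ _ _) (by rw [pathZ_zero, hν]) hx
  have hb : 0 ≤ shootBound p q A H L := by
    have := hpq.pos
    have := hpq.symm.pos
    unfold shootBound
    positivity
  have hM : 1 ≤ Real.exp (shootBound p q A H L) := Real.one_le_exp hb
  refine ⟨sq_add_sq_lower hpq (Real.exp_pos _) (Real.exp_le_one_iff.2 (by linarith)) e1,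
    abs_le_of_rpow_le hp hM ?_, abs_le_of_rpow_le hq hM ?_⟩
  · exact le_trans (le_add_of_nonneg_right (by positivity)) e2
  · exact le_trans (le_add_of_nonneg_left (by positivity)) e2

lemma shoot_congr {κ' : C(ℝ, ℝ)} (h : ∀ x : Icc (0 : ℝ) 1, κ (y.1 x) = κ' (y.1 x) ∧
    κ (y.2 x) = κ' (y.2 x)) :
    delayOp (shootPsi hq κ) (shootF hp a α β η κ) ν 0 v y =
      delayOp (shootPsi hq κ') (shootF hp a α β η κ') ν 0 v y := by
  refine Prod.ext (ContinuousMap.ext fun x => ?_) (ContinuousMap.ext fun x => ?_)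
  · refine intervalIntegral.integral_congr fun t _ => ?_
    exact congrArg (phip q) (h _).2
  · refine congrArg (ν - ·) (intervalIntegral.integral_congr fun t _ => ?_)
    exact congrArg (shootRhs p a α β η v t) (h _).1

lemma shoot_truncate (hpq : p.HolderConjugate q) (hν : |ν| = 1)
    (ha : ∀ t ∈ Icc (0 : ℝ) 1, |a t| ≤ A) (hα : ∀ t ∈ Icc (0 : ℝ) 1, |α t| ≤ A)
    (hβ : ∀ t ∈ Icc (0 : ℝ) 1, |β t| ≤ A) (hη : ∀ s, |η s| ≤ H) (hv : |v.1| ≤ L)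
    (hy : delayOp (shootPsi hq (.id ℝ)) (shootF hp a α β η (.id ℝ)) ν 0 v y = y) :
    delayOp (shootPsi hq (clampC (Real.exp (shootBound p q A H L))))
      (shootF hp a α β η (clampC (Real.exp (shootBound p q A H L)))) ν 0 v y = y := by
  refine (shoot_congr fun x => ?_).trans hy
  have h := shoot_energy (κ := .id ℝ) hpq (fun _ => le_rfl) hν ha hα hβ hη hv hy x.2
  have e := IsFixedPt.extend hy x.2
  rw [IccExtend_of_mem _ _ x.2, IccExtend_of_mem _ _ x.2] at e
  rw [← e.1, ← e.2] at h
  exact ⟨clampC_of_abs_le h.2.1, clampC_of_abs_le h.2.2⟩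

/-- Undelayed fixed points of the truncated operator are genuine rescaled solutions. -/
lemma shoot_polarPath (hpq : p.HolderConjugate q) (hν : |ν| = 1)
    (ha : ∀ t ∈ Icc (0 : ℝ) 1, |a t| ≤ A) (hα : ∀ t ∈ Icc (0 : ℝ) 1, |α t| ≤ A)
    (hβ : ∀ t ∈ Icc (0 : ℝ) 1, |β t| ≤ A) (hη : ∀ s, |η s| ≤ H) (hv : |v.1| ≤ L)
    {ψ : C(ℝ, ℝ)} {F : C((ℝ × ℝ) × ℝ × ℝ, ℝ)}
    (hψ : ψ = shootPsi hq (clampC (Real.exp (shootBound p q A H L))))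
    (hF : F = shootF hp a α β η (clampC (Real.exp (shootBound p q A H L))))
    (hy : delayOp ψ F ν 0 v y = y) :
    PolarPath q ν (fun x => shootRhs p a α β η v x (pathW ψ 0 y x)) (pathW ψ 0 y)
      (pathZ F ν 0 v y)
      (angleInt ψ F ((Real.exp (-shootBound p q A H L) / 2) ^ 2) v y) := by
  subst hψ hF
  have h := fun x (hx : x ∈ Icc (0 : ℝ) 1) => shoot_energy hpq
    (fun x => (abs_clampC_le (Real.exp_pos _).le x).1) hν ha hα hβ hη hv hy hx
  have hP := IsFixedPt.polarPath (q := q) hy (by positivity)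
    (fun x hx => congrArg (phip q) (clampC_of_abs_le (h x hx).2.2)) fun x hx => (h x hx).1
  have hG : ∀ x ∈ Icc (0 : ℝ) 1, shootF hp a α β η (clampC (Real.exp (shootBound p q A H L)))
      (v, x, pathW (shootPsi hq (clampC (Real.exp (shootBound p q A H L)))) 0 y x) =
      shootRhs p a α β η v x
        (pathW (shootPsi hq (clampC (Real.exp (shootBound p q A H L)))) 0 y x) :=
    fun x hx => congrArg (shootRhs p a α β η v x) (clampC_of_abs_le (h x hx).2.1)
  exact ⟨hP.W_deriv, fun x hx => hG x hx ▸ hP.Z_deriv x hx, fun x hx => by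
    have := hP.angle_deriv x hx
    rwa [hG x hx] at this, hP.pos, hP.W_zero, hP.Z_zero, hP.angle_zero⟩

end Shooting

section Continuation

/-- Zero sets of a parametrised fixed-point problem approximable by continuously solvable ones
cannot be separated from the boundary. -/
lemma not_separated_of_approx {Y : Type*} [MetricSpace Y] {T : ℝ → ℝ × ℝ → Y → Y}
    (hT : Continuous fun z : ℝ × (ℝ × ℝ) × Y => T z.1 z.2.1 z.2.2) {C : Set Y}
    (hC : IsCompact C) {l L S κ : ℝ} (hlL : l ≤ L) (hS : 0 ≤ S)
    (hTC : ∀ δ, ∀ v ∈ Icc l L ×ˢ Icc 0 S, ∀ y, T δ v y ∈ C)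
    (hfix : ∀ δ > 0, ∃ f : ℝ × ℝ → Y, Continuous f ∧ ∀ v, T δ v (f v) = f v)
    {Θ : (ℝ × ℝ) × Y → ℝ} (hΘ : Continuous Θ)
    (hl : ∀ y, T 0 (l, 0) y = y → Θ ((l, 0), y) < κ)
    (hL : ∀ y, T 0 (L, 0) y = y → κ < Θ ((L, 0), y))
    {A B : Set ((ℝ × ℝ) × Y)} (hA : IsClosed A) (hB : IsClosed B) (hAB : Disjoint A B)
    (hcover : ∀ v ∈ Icc l L ×ˢ Icc 0 S, ∀ y, T 0 v y = y → Θ (v, y) = κ → (v, y) ∈ A ∪ B)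
    (hbot : ∀ v ∈ Icc l L ×ˢ Icc 0 S, ∀ y, T 0 v y = y → Θ (v, y) = κ → v.2 = 0 → (v, y) ∈ A)
    (hside : ∀ v ∈ Icc l L ×ˢ Icc 0 S, ∀ y, T 0 v y = y → Θ (v, y) = κ →
      (v.1 = l ∨ v.1 = L ∨ v.2 = S) → (v, y) ∈ B) : False := by
  obtain ⟨f, hfA, hfB, -⟩ := exists_continuous_zero_one_of_isClosed hA hB hAB
  set m : (ℝ × ℝ) × Y → ℝ := fun z => 1 / 2 - f z with hm
  have hmc : Continuous m := by fun_prop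
  have hmA : ∀ z ∈ A, 0 < m z := fun z hz => by simp [hm, hfA hz]
  have hmB : ∀ z ∈ B, m z < 0 := fun z hz => by simp only [hm, hfB hz, Pi.one_apply]; norm_num
  set bad : Set (ℝ × (ℝ × ℝ) × Y) := {z | z ∈ Icc (0 : ℝ) 1 ×ˢ (Icc l L ×ˢ Icc 0 S) ×ˢ C ∧
    T z.1 z.2.1 z.2.2 = z.2.2 ∧
    ((Θ z.2 = κ ∧ (m z.2 = 0 ∨ (z.2.1.2 = 0 ∧ m z.2 ≤ 0) ∨
      ((z.2.1.1 = l ∨ z.2.1.1 = L ∨ z.2.1.2 = S) ∧ 0 ≤ m z.2))) ∨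
      (z.2.1 = (l, 0) ∧ κ ≤ Θ z.2) ∨ (z.2.1 = (L, 0) ∧ Θ z.2 ≤ κ))} with hbad
  have hcpt : IsCompact bad := by
    refine (isCompact_Icc.prod ((isCompact_Icc.prod isCompact_Icc).prod hC)).inter_right ?_
    have c1 {g : ℝ × (ℝ × ℝ) × Y → ℝ} (hg : Continuous g) (c : ℝ) : IsClosed {z | g z = c} :=
      isClosed_eq hg continuous_const
    have c2 {g : ℝ × (ℝ × ℝ) × Y → ℝ} (hg : Continuous g) (c : ℝ) : IsClosed {z | g z ≤ c} :=
      isClosed_le hg continuous_const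
    have c3 {g : ℝ × (ℝ × ℝ) × Y → ℝ} (hg : Continuous g) (c : ℝ) : IsClosed {z | c ≤ g z} :=
      isClosed_le continuous_const hg
    have c4 (w : ℝ × ℝ) : IsClosed {z : ℝ × (ℝ × ℝ) × Y | z.2.1 = w} :=
      isClosed_eq (by fun_prop) continuous_const
    have hΘ' : Continuous fun z : ℝ × (ℝ × ℝ) × Y => Θ z.2 := by fun_prop
    have hm' : Continuous fun z : ℝ × (ℝ × ℝ) × Y => m z.2 := by fun_prop
    have hx' : Continuous fun z : ℝ × (ℝ × ℝ) × Y => z.2.1.1 := by fun_prop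
    have hs' : Continuous fun z : ℝ × (ℝ × ℝ) × Y => z.2.1.2 := by fun_prop
    exact (isClosed_eq hT (by fun_prop)).inter
      (((c1 hΘ' κ).inter ((c1 hm' 0).union (((c1 hs' 0).inter (c2 hm' 0)).union
        (((c1 hx' l).union ((c1 hx' L).union (c1 hs' S))).inter (c3 hm' 0))))).union
        (((c4 (l, 0)).inter (c3 hΘ' κ)).union ((c4 (L, 0)).inter (c2 hΘ' κ))))
  have hproj := (hcpt.image continuous_fst).isClosed
  have h0 : (0 : ℝ) ∉ Prod.fst '' bad := by
    rintro ⟨⟨δ, v, y⟩, ⟨⟨-, hv, -⟩, hy, hz⟩, rfl⟩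
    rcases hz with ⟨hθ, h | ⟨h1, h2⟩ | ⟨h1, h2⟩⟩ | ⟨h1, h2⟩ | ⟨h1, h2⟩
    · rcases hcover v hv y hy hθ with hz | hz
      · exact (hmA _ hz).ne' h
      · exact (hmB _ hz).ne h
    · exact h2.not_gt (hmA _ (hbot v hv y hy hθ h1))
    · exact h2.not_gt (hmB _ (hside v hv y hy hθ h1))
    · change v = _ at h1
      subst h1
      exact h2.not_gt (hl y hy)
    · change v = _ at h1
      subst h1
      exact h2.not_gt (hL y hy)
  obtain ⟨ε, hε, hball⟩ := Metric.isOpen_iff.1 hproj.isOpen_compl 0 h0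
  set δ := min (ε / 2) 1 with hδ
  have hδ0 : 0 < δ := by positivity
  have hδmem : δ ∈ Icc (0 : ℝ) 1 := ⟨hδ0.le, min_le_right _ _⟩
  have hδbad : δ ∉ Prod.fst '' bad := by
    apply hball
    rw [Metric.mem_ball, Real.dist_eq, sub_zero, abs_of_pos hδ0]
    linarith [min_le_left (ε / 2) 1]
  obtain ⟨g, hg, hgfix⟩ := hfix δ hδ0
  have hgood : ∀ v ∈ Icc l L ×ˢ Icc 0 S, ¬ ((Θ (v, g v) = κ ∧ (m (v, g v) = 0 ∨
      (v.2 = 0 ∧ m (v, g v) ≤ 0) ∨ ((v.1 = l ∨ v.1 = L ∨ v.2 = S) ∧ 0 ≤ m (v, g v)))) ∨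
      (v = (l, 0) ∧ κ ≤ Θ (v, g v)) ∨ (v = (L, 0) ∧ Θ (v, g v) ≤ κ)) := by
    intro v hv hcon
    exact hδbad ⟨(δ, v, g v), ⟨⟨hδmem, hv, hgfix v ▸ hTC δ v hv (g v)⟩, hgfix v, hcon⟩, rfl⟩
  have hmem : ∀ x ∈ Icc l L, ∀ s ∈ Icc 0 S, ((x, s) : ℝ × ℝ) ∈ Icc l L ×ˢ Icc 0 S :=
    fun x hx s hs => ⟨hx, hs⟩
  refine planar_continuation hlL hS (h := fun v => Θ (v, g v) - κ) (m := fun v => m (v, g v))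
    (by fun_prop) (by fun_prop) ?_ ?_ ?_ ?_ ?_
  · by_contra! hcon
    exact hgood (l, 0) (hmem l ⟨le_rfl, hlL⟩ 0 ⟨le_rfl, hS⟩)
      (.inr (.inl ⟨rfl, by linarith⟩))
  · by_contra! hcon
    exact hgood (L, 0) (hmem L ⟨hlL, le_rfl⟩ 0 ⟨le_rfl, hS⟩)
      (.inr (.inr ⟨rfl, by linarith⟩))
  · intro x hx s hs hz hm0
    exact hgood (x, s) (hmem x hx s hs) (.inl ⟨sub_eq_zero.1 hz, .inl hm0⟩)
  · intro x hx hz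
    by_contra! hcon
    exact hgood (x, 0) (hmem x hx 0 ⟨le_rfl, hS⟩)
      (.inl ⟨sub_eq_zero.1 hz, .inr (.inl ⟨rfl, hcon⟩)⟩)
  · intro x hx s hs hb hz
    by_contra! hcon
    exact hgood (x, s) (hmem x hx s hs)
      (.inl ⟨sub_eq_zero.1 hz, .inr (.inr ⟨hb, hcon⟩)⟩)

/-- If the image of a compact set cannot be separated between a point and the outside of a ball,
then it contains a connected set joining them. -/
lemma exists_isConnected_of_not_separated {Z X : Type*} [TopologicalSpace Z] [T2Space Z]
    [NormedAddCommGroup X] {K : Set Z} (hK : IsCompact K) {π : Z → X} (hπ : Continuous π) {R : ℝ}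
    {x₀ : X} (hx₀ : x₀ ∈ π '' K) (hR : ‖x₀‖ < R)
    (hsep : ∀ A B : Set Z, IsClosed A → IsClosed B → Disjoint A B → A ∪ B = K →
      (∀ z ∈ K, π z = x₀ → z ∈ A) → (∀ z ∈ K, R ≤ ‖π z‖ → z ∈ B) → False) :
    ∃ D ⊆ π '' K, IsConnected D ∧ x₀ ∈ D ∧ (∀ x ∈ D, ‖x‖ ≤ R) ∧ ∃ x ∈ D, R ≤ ‖x‖ := by
  set Q : Set X := π '' K ∩ Metric.closedBall 0 R with hQ
  have hQc : IsCompact Q := (hK.image hπ).inter_right Metric.isClosed_closedBall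
  have hxQ : x₀ ∈ Q := ⟨hx₀, by simpa using hR.le⟩
  refine ⟨connectedComponentIn Q x₀, (connectedComponentIn_subset _ _).trans inter_subset_left,
    isConnected_connectedComponentIn_iff.2 hxQ, mem_connectedComponentIn hxQ,
    fun x hx => by simpa using (connectedComponentIn_subset _ _ hx).2, ?_⟩
  by_contra! hcon
  have : CompactSpace Q := isCompact_iff_compactSpace.1 hQc
  set N : Set Q := {x | R ≤ ‖(x : X)‖} with hN
  have hNc : IsClosed N := isClosed_le continuous_const (by fun_prop)
  have hempty : N ∩ ⋂ s : { s : Set Q // IsClopen s ∧ (⟨x₀, hxQ⟩ : Q) ∈ s }, (s : Set Q) = ∅ := by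
    rw [← connectedComponent_eq_iInter_isClopen]
    ext x
    simp only [mem_inter_iff, mem_empty_iff_false, iff_false, not_and]
    intro hx hmem
    refine (hcon x ?_).not_ge hx
    rw [connectedComponentIn_eq_image hxQ]
    exact mem_image_of_mem _ hmem
  obtain ⟨t, ht⟩ := hNc.isCompact.elim_finite_subfamily_closed _ (fun s => s.2.1.1) hempty
  set A' : Set Q := ⋂ i ∈ t, (i : Set Q) with hA'
  have hclopen : IsClopen A' := isClopen_biInter_finset fun s _ => s.2.1
  have hxA : (⟨x₀, hxQ⟩ : Q) ∈ A' := mem_iInter₂.2 fun s _ => s.2.2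
  have hcl : ∀ s : Set Q, IsClosed s → IsClosed (K ∩ π ⁻¹' (Subtype.val '' s)) := fun s hs =>
    hK.isClosed.inter ((hQc.isClosed.isClosedEmbedding_subtypeVal.isClosedMap s hs).preimage hπ)
  refine hsep (K ∩ π ⁻¹' (Subtype.val '' A'))
    ((K ∩ π ⁻¹' (Subtype.val '' A'ᶜ)) ∪ (K ∩ {z | R ≤ ‖π z‖})) (hcl _ hclopen.1)
    ((hcl _ hclopen.compl.1).union (hK.isClosed.inter
      (isClosed_le continuous_const (by fun_prop)))) ?_ ?_ ?_ ?_
  · rw [Set.disjoint_left]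
    rintro z ⟨-, x, hx, hxz⟩ (⟨-, x', hx', hxz'⟩ | ⟨-, hz⟩)
    · exact hx' (Subtype.ext (hxz'.trans hxz.symm) ▸ hx)
    · have : x ∈ N ∩ A' := ⟨by rw [hN, mem_ofPred_eq, hxz]; exact hz, hx⟩
      rw [ht] at this
      exact this
  · ext z
    constructor
    · rintro (h | h | h) <;> exact h.1
    · intro hz
      by_cases hR' : R ≤ ‖π z‖
      · exact .inr (.inr ⟨hz, hR'⟩)
      · have hzQ : π z ∈ Q := ⟨mem_image_of_mem _ hz, by simpa using (not_le.1 hR').le⟩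
        by_cases hzA : (⟨π z, hzQ⟩ : Q) ∈ A'
        · exact .inl ⟨hz, _, hzA, rfl⟩
        · exact .inr (.inl ⟨hz, _, hzA, rfl⟩)
  · exact fun z hz h => ⟨hz, _, hxA, h.symm⟩
  · exact fun z hz h => .inr ⟨hz, h⟩

end Continuation

section Translation

variable {p q : ℝ}

/-- The quotient `ζ / (f₀ φ_p)` extends continuously by `0`. -/
lemma exists_continuous_ratio (hp : 1 < p) {ζ : ℝ → ℝ} (hζ : Continuous ζ)
    (hζ0 : Tendsto (fun s => ζ s / phip p s) (𝓝[≠] (0 : ℝ)) (𝓝 0)) {f0 : ℝ} (hf0 : 0 < f0) :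
    ∃ η : C(ℝ, ℝ), η 0 = 0 ∧ ∀ u, f0 * phip p u * η u = ζ u := by
  have hφ := continuous_phip hp
  have hz0 : ζ 0 = 0 := by
    have h1 : Tendsto ζ (𝓝[≠] (0 : ℝ)) (𝓝 (ζ 0)) := (hζ.tendsto 0).mono_left nhdsWithin_le_nhds
    have h2 := hζ0.mul ((hφ.tendsto 0).mono_left (nhdsWithin_le_nhds (s := {0}ᶜ)))
    rw [zero_mul] at h2
    refine tendsto_nhds_unique h1 (h2.congr' ?_)
    filter_upwards [self_mem_nhdsWithin] with x hx
    exact div_mul_cancel₀ _ (phip_ne_zero hx)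
  have hval : ∀ u, f0 * phip p u * (ζ u / phip p u / f0) = ζ u := by
    intro u
    rcases eq_or_ne u 0 with rfl | hu
    · simp [phip_zero, hz0]
    · have := phip_ne_zero (p := p) hu
      field_simp
  have h00 : ζ 0 / phip p 0 / f0 = 0 := by rw [hz0, zero_div, zero_div]
  refine ⟨⟨fun u => ζ u / phip p u / f0, ?_⟩, h00, hval⟩
  rw [continuous_iff_continuousAt]
  intro u
  rcases eq_or_ne u 0 with rfl | hu
  · rw [continuousAt_iff_punctured_nhds]
    simpa [hz0] using hζ0.div_const f0
  · exact (hζ.continuousAt.div hφ.continuousAt (phip_ne_zero hu)).div_const f0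

lemma halfRhs_smul {s : ℝ} (hs : 0 < s) (a α β : ℝ → ℝ) (μ x w : ℝ) :
    halfRhs p a α β μ x (s * w) = phip p s * halfRhs p a α β μ x w := by
  have h1 : max (s * w) 0 = s * max w 0 := by rw [mul_max_of_nonneg _ _ hs.le, mul_zero]
  have h2 : -min (s * w) 0 = s * -min w 0 := by
    rw [mul_neg, mul_min_of_nonneg _ _ hs.le, mul_zero]
  simp only [halfRhs, h1, h2, phip_mul]
  ring

lemma shootRhs_zero {a α β η : C(ℝ, ℝ)} (hη : η 0 = 0) (μ t w : ℝ) :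
    shootRhs p a α β η (μ, 0) t w = halfRhs p a α β μ t w := by
  simp [shootRhs, hη]

/-- A half-eigenfunction gives a fixed point of the shooting operator at `s = 0`. -/
lemma exists_fixedPt_of_isHalfSol (hpq : p.HolderConjugate q) {hp : 1 < p} {hq : 1 < q}
    {a α β : ℝ → ℝ} {a' α' β' η : C(ℝ, ℝ)} (ha : ∀ x ∈ Icc (0 : ℝ) 1, a' x = a x)
    (hα : ∀ x ∈ Icc (0 : ℝ) 1, α' x = α x) (hβ : ∀ x ∈ Icc (0 : ℝ) 1, β' x = β x) (hη : η 0 = 0)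
    {ν lam : ℝ} (hν : |ν| = 1) {k : ℕ} {u : ℝ → ℝ} (hu : IsHalfSol p a α β lam u)
    (hS : MemS k ν u) :
    ∃ d > 0, ∃ y : CI × CI, delayOp (shootPsi hq (.id ℝ)) (shootF hp a' α' β' η (.id ℝ)) ν 0
      (lam, 0) y = y ∧ ∀ x : Icc (0 : ℝ) 1, y.1 x = u x / d := by
  obtain ⟨⟨hC, hu0, hu1⟩, -, -, hsimple, δ, hδ, hpos⟩ := hS
  have h0 : (0 : ℝ) ∈ Icc (0 : ℝ) 1 := ⟨le_rfl, zero_le_one⟩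
  have hdiff : Differentiable ℝ u := hC.differentiable one_ne_zero
  have hdc : Continuous (deriv u) := hC.continuous_deriv le_rfl
  have hν2 : ν * ν = 1 := by rw [← abs_mul_abs_self, hν, one_mul]
  set d := ν * deriv u 0 with hd
  have hd0 : 0 < d := by
    refine lt_of_le_of_ne ?_ (Ne.symm (mul_ne_zero ?_ (hsimple 0 h0 hu0)))
    · have h1 := (hasDerivAt_iff_tendsto_slope.1 (hdiff 0).hasDerivAt).const_mul ν
      refine ge_of_tendsto (h1.mono_left (nhdsWithin_mono 0 (s := Ioi 0)
        fun x hx => ne_of_gt hx)) ?_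
      filter_upwards [Ioo_mem_nhdsGT hδ] with x hx
      rw [slope_def_field, hu0, sub_zero, sub_zero, ← mul_div_assoc]
      exact (div_pos (hpos x hx) hx.1).le
    · rintro rfl
      simp at hν
  have hdν : deriv u 0 / d = ν := by
    rw [div_eq_iff hd0.ne', hd, ← mul_assoc, hν2, one_mul]
  have hφ := continuous_phip hp
  set y : CI × CI :=
    (⟨fun x => u x / d, by fun_prop⟩, ⟨fun x => phip p (deriv u x / d), by fun_prop⟩)
    with hy
  have e1 : ∀ t ∈ Icc (0 : ℝ) 1, IccExtend zero_le_one y.1 (t - 0) = u t / d := fun t ht => by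
    rw [sub_zero, IccExtend_of_mem _ _ ht]
    rfl
  have e2 : ∀ t ∈ Icc (0 : ℝ) 1, IccExtend zero_le_one y.2 (t - 0) = phip p (deriv u t / d) :=
    fun t ht => by
      rw [sub_zero, IccExtend_of_mem _ _ ht]
      rfl
  refine ⟨d, hd0, y, Prod.ext (ContinuousMap.ext fun x => ?_) (ContinuousMap.ext fun x => ?_),
    fun x => rfl⟩
  · change (∫ t in (0 : ℝ)..x, phip q (IccExtend zero_le_one y.2 (t - 0))) = u x / d
    rw [intervalIntegral.integral_congr (g := fun t => deriv u t / d) fun t ht => ?_]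
    · rw [intervalIntegral.integral_div, intervalIntegral.integral_deriv_eq_sub
        (fun t _ => hdiff t) (hdc.intervalIntegrable _ _), hu0, sub_zero]
    · rw [uIcc_of_le x.2.1] at ht
      simp only
      rw [e2 t ⟨ht.1, ht.2.trans x.2.2⟩, phip_phip hpq.symm]
  · change ν - (∫ t in (0 : ℝ)..x, shootRhs p a' α' β' η (lam, 0) t
      (IccExtend zero_le_one y.1 (t - 0))) = phip p (deriv u x / d)
    have hg : Continuous fun t => shootRhs p a' α' β' η (lam, 0) t (u t / d) :=
      (continuous_shootRhs hp a' α' β' η).comp (f := fun t : ℝ => (((lam, 0), t, u t / d) :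
        (ℝ × ℝ) × ℝ × ℝ)) (by fun_prop)
    rw [intervalIntegral.integral_congr
      (g := fun t => shootRhs p a' α' β' η (lam, 0) t (u t / d)) fun t ht => ?_]
    · have hder : ∀ t ∈ Ioo (0 : ℝ) x, HasDerivAt (fun t => -phip p (deriv u t / d))
          (shootRhs p a' α' β' η (lam, 0) t (u t / d)) t := by
        intro t ht
        have ht1 : t ∈ Ioo (0 : ℝ) 1 := ⟨ht.1, ht.2.trans_le x.2.2⟩
        have ht2 := Ioo_subset_Icc_self ht1
        have h1 := ((hu.2 t ht1).const_mul (phip p d⁻¹)).neg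
        have hfun : (fun t => -phip p (deriv u t / d)) =
            fun t => -(phip p d⁻¹ * phip p (deriv u t)) := by
          ext t
          rw [← phip_mul, div_eq_inv_mul]
        rw [hfun]
        refine h1.congr_deriv ?_
        rw [shootRhs_zero hη, div_eq_inv_mul, halfRhs_smul (inv_pos.2 hd0), halfRhs, ha t ht2,
          hα t ht2, hβ t ht2]
        ring
      rw [intervalIntegral.integral_eq_sub_of_hasDerivAt_of_le x.2.1 (by fun_prop) hder
        (hg.intervalIntegrable _ _), hdν]
      have hνφ : phip p ν = ν := by rw [phip, hν, Real.one_rpow, one_mul]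
      rw [hνφ]
      ring
    · rw [uIcc_of_le x.2.1] at ht
      simp only
      rw [e1 t ⟨ht.1, ht.2.trans x.2.2⟩]

/-- A rescaled solution with `s > 0` and terminal angle `k π` gives a nodal solution. -/
lemma exists_solution_of_polarPath (hpq : p.HolderConjugate q) {a α β ζ : ℝ → ℝ}
    {a' α' β' η₀ η : C(ℝ, ℝ)} (ha : ∀ x ∈ Icc (0 : ℝ) 1, a' x = a x)
    (hα : ∀ x ∈ Icc (0 : ℝ) 1, α' x = α x) (hβ : ∀ x ∈ Icc (0 : ℝ) 1, β' x = β x)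
    {r f0 R : ℝ} (hη₀ : ∀ u, f0 * phip p u * η₀ u = ζ u) (hη : ∀ u, |u| ≤ R → η u = η₀ u)
    {ν lam s : ℝ} (hs : 0 < s) {k : ℕ} {ψ : C(ℝ, ℝ)} {F : C((ℝ × ℝ) × ℝ × ℝ, ℝ)}
    {y : CI × CI} {θ : ℝ → ℝ} (hy : delayOp ψ F ν 0 (lam * (r * f0), s) y = y)
    (h : PolarPath q ν (fun x => shootRhs p a' α' β' η (lam * (r * f0), s) x (pathW ψ 0 y x))
      (pathW ψ 0 y) (pathZ F ν 0 (lam * (r * f0), s) y) θ) (hθ : θ 1 = k * Real.pi)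
    (hR : ∀ x : Icc (0 : ℝ) 1, |s * y.1 x| ≤ R) :
    ∃ u, IsSolLam p r f0 a α β ζ lam u ∧ Nontriv u ∧ MemS k ν u ∧
      ReprE u (s • y.1, s • ψ.comp y.2) := by
  have hq := hpq.symm.lt
  set W := pathW ψ 0 y with hW
  set Z := pathZ F ν 0 (lam * (r * f0), s) y with hZ
  have h1 : (1 : ℝ) ∈ Icc (0 : ℝ) 1 := ⟨zero_le_one, le_rfl⟩
  have hder : ∀ x, HasDerivAt (fun x => s * W x) (s * ψ (IccExtend zero_le_one y.2 (x - 0))) x :=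
    fun x => (hasDerivAt_pathW ψ 0 y x).const_mul s
  have hderiv : deriv (fun x => s * W x) = fun x => s * ψ (IccExtend zero_le_one y.2 (x - 0)) :=
    funext fun x => (hder x).deriv
  have hderIcc : ∀ x ∈ Icc (0 : ℝ) 1, deriv (fun x => s * W x) x = s * phip q (Z x) := fun x hx =>
    ((h.W_deriv x hx).const_mul s).deriv
  have hE : MemE fun x => s * W x := by
    refine ⟨?_, by simp [hW, pathW_zero], ?_⟩
    · rw [contDiff_one_iff_deriv]
      refine ⟨fun x => (hder x).differentiableAt, ?_⟩
      rw [hderiv]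
      have : Continuous (IccExtend (zero_le_one (α := ℝ)) y.2) := y.2.continuous.Icc_extend'
      fun_prop
    · have : W 1 = 0 := by rw [h.W_eq_zero_iff h1, hθ, Real.sin_nat_mul_pi]
      simp [this]
  obtain ⟨hfin, hcard⟩ := h.zeros_ncard hq hθ
  obtain ⟨δ, hδ, hpos⟩ := h.exists_pos_near_zero hq
  refine ⟨fun x => s * W x, ⟨hE, fun x hx => ?_⟩, ?_, ⟨hE, ?_, ?_, ?_, δ, hδ, ?_⟩, ?_, ?_⟩
  · have hx' := Ioo_subset_Icc_self hx
    have hev : (fun y => phip p (deriv (fun x => s * W x) y)) =ᶠ[𝓝 x] fun y => phip p s * Z y := by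
      filter_upwards [Ioo_mem_nhds hx.1 hx.2] with y hy
      rw [hderIcc y (Ioo_subset_Icc_self hy), phip_mul, phip_phip hpq]
    refine HasDerivAt.congr_of_eventuallyEq ?_ hev
    refine ((h.Z_deriv x hx').const_mul (phip p s)).congr_deriv ?_
    have hWy : W x = y.1 ⟨x, hx'⟩ := by
      rw [hW, ← (IsFixedPt.extend hy hx').1, IccExtend_of_mem _ _ hx']
    have hz : η (s * W x) = η₀ (s * W x) := hη _ (hWy ▸ hR ⟨x, hx'⟩)
    rw [← hη₀, shootRhs, mul_neg, mul_add, ← halfRhs_smul hs, hz, halfRhs, ha x hx', hα x hx',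
      hβ x hx', phip_mul p s (W x)]
    ring
  · have hδ1 : 0 < min δ 1 := by positivity
    have hm : min δ 1 / 2 ∈ Ioo 0 δ := ⟨by positivity, by linarith [min_le_left δ 1]⟩
    refine ⟨min δ 1 / 2, ⟨hm.1.le, by linarith [min_le_right δ 1]⟩, mul_ne_zero hs.ne' ?_⟩
    exact right_ne_zero_of_mul (hpos _ hm).ne'
  · simpa [hs.ne'] using hfin
  · simpa [hs.ne'] using hcard
  · intro x hx h0
    rw [hderIcc x hx]
    have hWx : W x = 0 := by simpa [hs.ne'] using h0
    exact mul_ne_zero hs.ne' (phip_ne_zero (h.Z_ne_zero hx hWx))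
  · intro x hx
    have := mul_pos hs (hpos x hx)
    linarith
  · intro x
    change s * y.1 x = s * W x
    rw [hW, ← (IsFixedPt.extend hy x.2).1, IccExtend_of_mem _ _ x.2]
  · intro x
    rw [hderiv]
    change s * ψ (y.2 x) = s * ψ (IccExtend zero_le_one y.2 (x - 0))
    rw [sub_zero, IccExtend_of_mem _ _ x.2]

end Translation

section Continuum

variable {p q : ℝ}

lemma angle_lt_of_lt (hpq : p.HolderConjugate q) {a α β : ℝ → ℝ} {μ₁ μ₂ ν : ℝ}
    {W₁ Z₁ θ₁ W₂ Z₂ θ₂ : ℝ → ℝ} (hμ : μ₁ < μ₂) (ha : ∀ x ∈ Icc (0 : ℝ) 1, 0 < a x)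
    (h₁ : PolarPath q ν (fun x => halfRhs p a α β μ₁ x (W₁ x)) W₁ Z₁ θ₁)
    (h₂ : PolarPath q ν (fun x => halfRhs p a α β μ₂ x (W₂ x)) W₂ Z₂ θ₂) {k : ℕ} (hk : 1 ≤ k)
    (hθ : θ₂ 1 = k * Real.pi) : θ₁ 1 < k * Real.pi := by
  obtain ⟨j, rfl⟩ := Nat.exists_eq_add_of_le' hk
  by_contra! hcon
  obtain ⟨x, hx, hxθ⟩ := intermediate_value_Icc zero_le_one h₁.continuousOn_angle
    (show ((j + 1 : ℕ) : ℝ) * Real.pi ∈ Icc (θ₁ 0) (θ₁ 1) from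
      ⟨by rw [h₁.angle_zero]; have := Real.pi_pos; positivity, hcon⟩)
  have hlt := angle_comparison hpq hμ ha h₁ h₂ j x hx hxθ
  rcases hx.2.eq_or_lt with rfl | hx1
  · exact hlt.ne hθ.symm
  · have := h₂.angle_crossing hpq.symm.lt (j := (j + 1 : ℕ)) hx.1 hx1 le_rfl
      (by exact_mod_cast hlt.le)
    rw [hθ] at this
    exact lt_irrefl _ (by exact_mod_cast this)

/-- The terminal angle of a path whose first component has `k - 1` interior zeros and vanishes
at `1`. -/
lemma PolarPath.angle_eq (hq : 1 < q) {ν : ℝ} {G W Z θ : ℝ → ℝ} (h : PolarPath q ν G W Z θ)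
    {k : ℕ} (hk : 1 ≤ k) (h1 : W 1 = 0) (hcard : {x ∈ Ioo (0 : ℝ) 1 | W x = 0}.ncard = k - 1) :
    θ 1 = k * Real.pi := by
  rw [h.W_eq_zero_iff ⟨zero_le_one, le_rfl⟩, Real.sin_eq_zero_iff] at h1
  obtain ⟨j, hj⟩ := h1
  have hpos := h.angle_pos hq one_pos le_rfl
  rw [← hj] at hpos
  have hj0 : 0 < j := by exact_mod_cast pos_of_mul_pos_left hpos Real.pi_pos.le
  lift j to ℕ using hj0.le
  have := (h.zeros_ncard hq (m := j) (by exact_mod_cast hj.symm)).2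
  have hjk : j = k := by omega
  rw [← hj, hjk]
  norm_cast

lemma exists_continuousMap_eqOn {f : ℝ → ℝ} (hf : ContinuousOn f (Icc 0 1)) :
    ∃ g : C(ℝ, ℝ), ∀ x ∈ Icc (0 : ℝ) 1, g x = f x :=
  ⟨⟨IccExtend zero_le_one ((Icc 0 1).domRestrict f), hf.domRestrict.Icc_extend'⟩, fun _ hx =>
    (IccExtend_of_mem zero_le_one ((Icc 0 1).domRestrict f) hx :)⟩

lemma exists_abs_le_on {f : C(ℝ, ℝ)} (l L : ℝ) : ∃ A, ∀ x ∈ Icc l L, |f x| ≤ A :=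
  isCompact_Icc.exists_bound_of_continuousOn f.continuous.continuousOn

/-- Solutions bifurcating from the half-eigenvalue reach the boundary of every large ball. -/
lemma exists_local_continuum (hpq : p.HolderConjugate q) {a α β : ℝ → ℝ}
    (ha : ContinuousOn a (Icc 0 1)) (hapos : ∀ x ∈ Icc (0 : ℝ) 1, 0 < a x)
    (hα : ContinuousOn α (Icc 0 1)) (hβ : ContinuousOn β (Icc 0 1))
    {ζ : ℝ → ℝ} (hζ : Continuous ζ)
    (hζ0 : Tendsto (fun s => ζ s / phip p s) (𝓝[≠] (0 : ℝ)) (𝓝 0))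
    {f0 : ℝ} (hf0 : 0 < f0) {r : ℝ} (hr : r ≠ 0) {k : ℕ} (hk : 1 ≤ k) {ν : ℝ} (hν : |ν| = 1)
    {lamk : ℝ} {u : ℝ → ℝ} (hu : IsHalfSol p a α β lamk u) (hSu : MemS k ν u) {R : ℝ}
    (hR : |lamk / (r * f0)| < R) :
    ∃ D : Set Xsp, IsConnected D ∧ (lamk / (r * f0), (0 : CI × CI)) ∈ D ∧
      (∀ x ∈ D, x = (lamk / (r * f0), (0 : CI × CI)) ∨
        ∃ u, IsSolLam p r f0 a α β ζ x.1 u ∧ Nontriv u ∧ MemS k ν u ∧ ReprE u x.2) ∧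
      ∃ x ∈ D, R ≤ ‖x‖ := by
  have hp := hpq.lt
  have hq := hpq.symm.lt
  have hrf : r * f0 ≠ 0 := mul_ne_zero hr hf0.ne'
  have hR0 : 0 < R := (abs_nonneg _).trans_lt hR
  have h01 : (0 : ℝ) ∈ Icc (0 : ℝ) 1 := ⟨le_rfl, zero_le_one⟩
  obtain ⟨a', ha'⟩ := exists_continuousMap_eqOn ha
  obtain ⟨α', hα'⟩ := exists_continuousMap_eqOn hα
  obtain ⟨β', hβ'⟩ := exists_continuousMap_eqOn hβ
  obtain ⟨A₁, hA₁⟩ := exists_abs_le_on (f := a') 0 1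
  obtain ⟨A₂, hA₂⟩ := exists_abs_le_on (f := α') 0 1
  obtain ⟨A₃, hA₃⟩ := exists_abs_le_on (f := β') 0 1
  obtain ⟨A, hAa, hAα, hAβ⟩ : ∃ A, (∀ t ∈ Icc (0 : ℝ) 1, |a' t| ≤ A) ∧
      (∀ t ∈ Icc (0 : ℝ) 1, |α' t| ≤ A) ∧ ∀ t ∈ Icc (0 : ℝ) 1, |β' t| ≤ A :=
    ⟨max A₁ (max A₂ A₃), fun t ht => (hA₁ t ht).trans (le_max_left _ _),
      fun t ht => (hA₂ t ht).trans ((le_max_left _ _).trans (le_max_right _ _)),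
      fun t ht => (hA₃ t ht).trans ((le_max_right _ _).trans (le_max_right _ _))⟩
  obtain ⟨η₀, hη₀0, hη₀⟩ := exists_continuous_ratio hp hζ hζ0 hf0
  set η : C(ℝ, ℝ) := η₀.comp (clampC R) with hη
  have hηeq : ∀ u, |u| ≤ R → η u = η₀ u := fun u hu => congrArg η₀ (clampC_of_abs_le hu)
  have hη0 : η 0 = 0 := (hηeq 0 (by simpa using hR0.le)).trans hη₀0
  obtain ⟨H, hH⟩ : ∃ H, ∀ s, |η s| ≤ H := by
    obtain ⟨H, hH⟩ := exists_abs_le_on (f := η₀) (-R) R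
    exact ⟨H, fun s => hH _ (abs_le.1 (abs_clampC_le hR0.le s).2)⟩
  set L := R * |r * f0| + |lamk| + 1 with hL
  have hlamL : |lamk| < L := by
    have : 0 ≤ R * |r * f0| := by positivity
    linarith
  obtain ⟨hlam1, hlam2⟩ := abs_lt.1 hlamL
  have hL0 : 0 < L := (abs_nonneg _).trans_lt hlamL
  set c := (Real.exp (-shootBound p q A H L) / 2) ^ 2 with hc
  have hc0 : 0 < c := by positivity
  set M := Real.exp (shootBound p q A H L) with hM
  have hM0 : 0 < M := Real.exp_pos _
  obtain ⟨ψ, hψ⟩ : ∃ ψ, ψ = shootPsi hq (clampC M) := ⟨_, rfl⟩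
  obtain ⟨F, hF⟩ : ∃ F, F = shootF hp a' α' β' η (clampC M) := ⟨_, rfl⟩
  have hpolar : ∀ v : ℝ × ℝ, |v.1| ≤ L → ∀ y, delayOp ψ F ν 0 v y = y →
      PolarPath q ν (fun x => shootRhs p a' α' β' η v x (pathW ψ 0 y x)) (pathW ψ 0 y)
        (pathZ F ν 0 v y) (angleInt ψ F c v y) := fun v hv y hy =>
    shoot_polarPath hpq hν hAa hAα hAβ hH hv hψ hF hy
  have hpolar0 : ∀ μ : ℝ, |μ| ≤ L → ∀ y, delayOp ψ F ν 0 (μ, 0) y = y →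
      PolarPath q ν (fun x => halfRhs p a' α' β' μ x (pathW ψ 0 y x)) (pathW ψ 0 y)
        (pathZ F ν 0 (μ, 0) y) (angleInt ψ F c (μ, 0) y) := fun μ hμ y hy => by
    simpa only [shootRhs_zero hη0] using hpolar (μ, 0) hμ y hy
  obtain ⟨d, hd, y₀, hy₀, hyu⟩ := exists_fixedPt_of_isHalfSol (η := η) (hp := hp) (hq := hq) hpq
    ha' hα' hβ' hη0 hν hu hSu
  replace hy₀ : delayOp ψ F ν 0 (lamk, 0) y₀ = y₀ := by
    rw [hψ, hF]
    exact shoot_truncate hpq hν hAa hAα hAβ hH hlamL.le hy₀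
  have hP₀ := hpolar0 lamk hlamL.le y₀ hy₀
  have hWu : ∀ x ∈ Icc (0 : ℝ) 1, pathW ψ 0 y₀ x = u x / d := fun x hx => by
    rw [← (IsFixedPt.extend hy₀ hx).1, IccExtend_of_mem _ _ hx, hyu]
  have hθ₀ : angleInt ψ F c (lamk, 0) y₀ 1 = k * Real.pi := by
    refine hP₀.angle_eq hq hk ?_ ?_
    · rw [hWu 1 ⟨zero_le_one, le_rfl⟩, hSu.1.2.2, zero_div]
    · rw [← hSu.2.2.1]
      congr 1
      ext x
      refine and_congr_right fun hx => ?_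
      rw [hWu x (Ioo_subset_Icc_self hx), div_eq_zero_iff, or_iff_left hd.ne']
  have hapos' : ∀ x ∈ Icc (0 : ℝ) 1, 0 < a' x := fun x hx => (ha' x hx).symm ▸ hapos x hx
  have hless : ∀ μ : ℝ, |μ| ≤ L → ∀ y, delayOp ψ F ν 0 (μ, 0) y = y → μ < lamk →
      angleInt ψ F c (μ, 0) y 1 < k * Real.pi := fun μ hμ y hy hlt =>
    angle_lt_of_lt hpq hlt hapos' (hpolar0 μ hμ y hy) hP₀ hk hθ₀
  have hgreater : ∀ μ : ℝ, |μ| ≤ L → ∀ y, delayOp ψ F ν 0 (μ, 0) y = y → lamk < μ →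
      k * Real.pi < angleInt ψ F c (μ, 0) y 1 := fun μ hμ y hy hlt => by
    obtain ⟨j, rfl⟩ := Nat.exists_eq_add_of_le' hk
    exact angle_comparison hpq hlt hapos' hP₀ (hpolar0 μ hμ y hy) j 1 ⟨zero_le_one, le_rfl⟩ hθ₀
  set V : Set (ℝ × ℝ) := Icc (-L) L ×ˢ Icc 0 (R + 1) with hV
  obtain ⟨C, hC, hTC⟩ : ∃ C : Set (CI × CI), IsCompact C ∧
      ∀ δ, ∀ v ∈ V, ∀ y, delayOp ψ F ν δ v y ∈ C := by
    have hclamp : ∀ x, |clampC M x| ≤ |M| := fun x =>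
      (abs_clampC_le hM0.le x).2.trans (le_abs_self M)
    have hA0 : 0 ≤ A := (abs_nonneg _).trans (hAa 0 h01)
    have hH0 : 0 ≤ H := (abs_nonneg _).trans (hH 0)
    refine exists_isCompact_delayOp_mem ψ F ν
      (B := max |phip q M| (A * (L * (1 + H) + 2) * |phip p M|)) (fun z => ?_)
      fun v hv t ht w => ?_
    · rw [hψ]
      exact (abs_phip_le hq (hclamp z)).trans (le_max_left _ _)
    · rw [hF]
      refine ((abs_shootRhs_le hp (hAa t ht) (hAα t ht) (hAβ t ht) hH (abs_le.2 hv.1) _).trans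
        ?_).trans (le_max_right _ _)
      exact mul_le_mul_of_nonneg_left (abs_phip_le hp (hclamp w)) (by positivity)
  have hT := continuous_delayOp ψ F ν
  have hΘ : Continuous fun z : (ℝ × ℝ) × CI × CI => angleInt ψ F c z.1 z.2 1 :=
    continuous_angleInt hc0 1
  set K : Set ((ℝ × ℝ) × CI × CI) := {z | z.1 ∈ V ∧ delayOp ψ F ν 0 z.1 z.2 = z.2 ∧
    angleInt ψ F c z.1 z.2 1 = k * Real.pi} with hKdef
  have hK : IsCompact K := by
    have hV_compact : IsCompact V := isCompact_Icc.prod isCompact_Icc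
    refine (hV_compact.prod hC).of_isClosed_subset ?_ ?_
    · exact ((isClosed_Icc.prod isClosed_Icc).preimage continuous_fst).inter
        ((isClosed_eq (hT.comp (f := fun z : (ℝ × ℝ) × CI × CI => ((0 : ℝ), z.1, z.2))
          (by fun_prop)) continuous_snd).inter (isClosed_eq hΘ continuous_const))
    · exact fun z hz => ⟨hz.1, hz.2.1 ▸ hTC 0 z.1 hz.1 z.2⟩
  set proj : (ℝ × ℝ) × CI × CI → Xsp := fun z =>
    (z.1.1 / (r * f0), z.1.2 • z.2.1, z.1.2 • ψ.comp z.2.2) with hprojdef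
  have hproj : Continuous proj := by
    have := ContinuousMap.continuous_postcomp (X := Icc (0 : ℝ) 1) ψ
    have h2 : Continuous fun z : (ℝ × ℝ) × CI × CI => ψ.comp z.2.2 :=
      this.comp (by fun_prop)
    fun_prop
  have hbase : ∀ z ∈ K, z.1.2 = 0 → proj z = (lamk / (r * f0), (0 : CI × CI)) := by
    rintro ⟨⟨μ, s⟩, y⟩ ⟨hv, hy, hθ⟩ (rfl : s = 0)
    have hμ : |μ| ≤ L := abs_le.2 hv.1
    have : μ = lamk := by
      rcases lt_trichotomy μ lamk with h | h | h
      · exact absurd hθ (hless μ hμ y hy h).ne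
      · exact h
      · exact absurd hθ (hgreater μ hμ y hy h).ne'
    simp [hprojdef, this, ← Prod.zero_eq_mk]
  have hx₀ : (lamk / (r * f0), (0 : CI × CI)) ∈ proj '' K := by
    have hmem : ((lamk, 0), y₀) ∈ K :=
      ⟨⟨⟨hlam1.le, hlam2.le⟩, le_rfl, by linarith⟩, hy₀, hθ₀⟩
    exact ⟨_, hmem, hbase _ hmem rfl⟩
  have hnorm₀ : ‖((lamk / (r * f0), (0 : CI × CI)) : Xsp)‖ < R := by
    rw [Prod.norm_mk, norm_zero, max_eq_left (norm_nonneg _)]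
    exact hR
  obtain ⟨D, hDsub, hDc, hx₀D, hDR, hDreach⟩ := exists_isConnected_of_not_separated hK hproj hx₀
    hnorm₀ fun A' B' hA' hB' hdisj hunion hzero hfar =>
      not_separated_of_approx hT hC (l := -L) (L := L) (S := R + 1) (κ := k * Real.pi)
        (by linarith) (by linarith) hTC
        (fun δ hδ => exists_continuous_fixedPt ψ F ν hδ) hΘ
        (fun y hy => hless (-L) (by rw [abs_neg, abs_of_pos hL0]) y hy hlam1)
        (fun y hy => hgreater L (abs_of_pos hL0).le y hy hlam2) hA' hB' hdisj
        (fun v hv y hy hθ => hunion ▸ (⟨hv, hy, hθ⟩ : (v, y) ∈ K))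
        (fun v hv y hy hθ h0 => hzero (v, y) ⟨hv, hy, hθ⟩ (hbase (v, y) ⟨hv, hy, hθ⟩ h0)) (by
          intro v hv y hy hθ hside
          refine hfar (v, y) ⟨hv, hy, hθ⟩ ?_
          have hL' : |v.1| = L → R ≤ ‖proj (v, y)‖ := by
            intro h
            refine le_trans ?_ (norm_fst_le (proj (v, y)))
            change R ≤ ‖v.1 / (r * f0)‖
            rw [Real.norm_eq_abs, abs_div, h, le_div_iff₀ (abs_pos.2 hrf)]
            linarith [abs_nonneg lamk]
          rcases hside with h | h | h
          · exact hL' (by rw [h, abs_neg, abs_of_pos hL0])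
          · exact hL' (by rw [h, abs_of_pos hL0])
          · refine le_trans ?_ ((norm_snd_le (proj (v, y)).2).trans (norm_snd_le (proj (v, y))))
            refine le_trans ?_ ((v.2 • ψ.comp y.2).norm_coe_le_norm ⟨0, h01⟩)
            have hP := hpolar v (abs_le.2 hv.1) y hy
            have hy2 : y.2 ⟨0, h01⟩ = ν := by
              have := (IsFixedPt.extend hy h01).2
              rwa [IccExtend_of_mem _ _ h01, pathZ_zero] at this
            have hder := (IsFixedPt.hasDerivAt hy h01).1.unique (hP.W_deriv 0 h01)
            rw [pathZ_zero] at hder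
            change R ≤ ‖v.2 * ψ (y.2 ⟨0, h01⟩)‖
            rw [hy2, hder, norm_mul, Real.norm_eq_abs, Real.norm_eq_abs, abs_phip hq, hν,
              Real.one_rpow, mul_one, h]
            exact le_trans (by linarith) (le_abs_self _))
  refine ⟨D, hDc, hx₀D, fun x hx => ?_, hDreach⟩
  obtain ⟨⟨⟨μ, s⟩, y⟩, ⟨hv, hy, hθ⟩, rfl⟩ := hDsub hx
  rcases hv.2.1.eq_or_lt with h0 | hs
  · exact .inl (hbase _ ⟨hv, hy, hθ⟩ h0.symm)
  · right
    have hμ : μ / (r * f0) * (r * f0) = μ := div_mul_cancel₀ _ hrf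
    have hP := hpolar (μ, s) (abs_le.2 hv.1) y hy
    rw [← hμ] at hP hy hθ
    refine exists_solution_of_polarPath hpq ha' hα' hβ' hη₀ hηeq hs hy hP hθ fun x' => ?_
    refine le_trans ?_ (hDR _ hx)
    exact ((s • y.1).norm_coe_le_norm x').trans
      ((norm_fst_le (proj ((μ, s), y)).2).trans (norm_snd_le (proj ((μ, s), y))))

lemma normE_le_of_reprE {u : ℝ → ℝ} {w : CI × CI} (h : ReprE u w) : normE u ≤ 2 * ‖w‖ := by
  have : Nonempty (Icc (0 : ℝ) 1) := ⟨0, le_rfl, zero_le_one⟩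
  have h1 : (⨆ x : Icc (0 : ℝ) 1, |u x|) ≤ ‖w‖ := ciSup_le fun x => by
    rw [← h.1 x]
    exact (w.1.norm_coe_le_norm x).trans (norm_fst_le w)
  have h2 : (⨆ x : Icc (0 : ℝ) 1, |deriv u x|) ≤ ‖w‖ := ciSup_le fun x => by
    rw [← h.2 x]
    exact (w.2.norm_coe_le_norm x).trans (norm_snd_le w)
  unfold normE
  linarith

lemma normE_nonneg (u : ℝ → ℝ) : 0 ≤ normE u :=
  add_nonneg (Real.iSup_nonneg fun _ => abs_nonneg _) (Real.iSup_nonneg fun _ => abs_nonneg _)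

end Continuum

end HalfLinear

/-- **Lemma 4.1**: `(λ_k^ν/(r f_0), 0)` is a bifurcation point of the eigenvalue problem,
with an unbounded continuum `𝒟_k^ν ⊆ (ℝ × S_k^ν) ∪ {(λ_k^ν/(r f_0), 0)}`. -/
theorem stmt11 (p : ℝ) (hp : 1 < p)
    (a α β : ℝ → ℝ)
    (ha : ContinuousOn a (Icc 0 1)) (hapos : ∀ x ∈ Icc (0:ℝ) 1, 0 < a x)
    (hα : ContinuousOn α (Icc 0 1)) (hβ : ContinuousOn β (Icc 0 1))
    (ζ : ℝ → ℝ) (hζ : Continuous ζ)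
    (hζ0 : Tendsto (fun s => ζ s / phip p s) (𝓝[≠] (0:ℝ)) (𝓝 0))
    (f0 : ℝ) (hf0 : 0 < f0) (r : ℝ) (hr : r ≠ 0)
    (k : ℕ) (hk : 1 ≤ k) (ν : ℝ) (hν : ν = 1 ∨ ν = -1)
    -- λ_k^ν : the k-th half-eigenvalue
    (lamk : ℝ) (hlamk : ∃ u, IsHalfSol p a α β lamk u ∧ MemS k ν u) :
    -- (λ_k^ν/(r f_0), 0) is a bifurcation point
    (∃ lamn : ℕ → ℝ, ∃ un : ℕ → ℝ → ℝ,
      (∀ n : ℕ, IsSolLam p r f0 a α β ζ (lamn n) (un n) ∧ Nontriv (un n)) ∧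
      Tendsto lamn atTop (𝓝 (lamk / (r * f0))) ∧
      Tendsto (fun n => normE (un n)) atTop (𝓝 0)) ∧
    -- the unbounded continuum
    (let SolX : Set Xsp := {z | ∃ u, IsSolLam p r f0 a α β ζ z.1 u ∧ Nontriv u ∧ ReprE u z.2}
     let SkX : Set Xsp := {z | ∃ u, MemS k ν u ∧ ReprE u z.2}
     ∃ D : Set Xsp,
       D ⊆ closure SolX ∧ (lamk / (r * f0), (0 : CI × CI)) ∈ D ∧ IsConnected D ∧
       ¬ Bornology.IsBounded D ∧ D ⊆ SkX ∪ {(lamk / (r * f0), (0 : CI × CI))}) := by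
  have hν' : |ν| = 1 := by rcases hν with rfl | rfl <;> simp
  obtain ⟨u, hu, hSu⟩ := hlamk
  set x₀ : Xsp := (lamk / (r * f0), (0 : CI × CI)) with hx₀
  have hnorm₀ : ‖x₀‖ = |lamk / (r * f0)| := by
    rw [hx₀, Prod.norm_mk, norm_zero, max_eq_left (norm_nonneg _), Real.norm_eq_abs]
  choose D hDc hx₀D hDsol hDfar using fun n : ℕ =>
    HalfLinear.exists_local_continuum (Real.HolderConjugate.conjExponent hp) ha hapos hα hβ hζ
      hζ0 hf0 hr hk hν' hu hSu
      (show |lamk / (r * f0)| < |lamk / (r * f0)| + 1 + n by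
        linarith [(Nat.cast_nonneg n : (0 : ℝ) ≤ n)])
  set SolX : Set Xsp := {z | ∃ u, IsSolLam p r f0 a α β ζ z.1 u ∧ Nontriv u ∧ ReprE u z.2}
    with hSolX
  have hsub : ∀ n, ∀ x ∈ D n, x ≠ x₀ → x ∈ SolX := fun n x hx hne =>
    let ⟨v, h1, h2, _, h4⟩ := (hDsol n x hx).resolve_left hne
    ⟨v, h1, h2, h4⟩
  have hx₀cl : x₀ ∈ closure SolX := by
    have hnt : (D 0).Nontrivial := by
      obtain ⟨x, hx, hxR⟩ := hDfar 0
      refine ⟨x, hx, x₀, hx₀D 0, ?_⟩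
      rintro rfl
      rw [hnorm₀] at hxR
      push_cast at hxR
      linarith
    have hacc := (hDc 0).isPreconnected.preperfect_of_nontrivial hnt x₀ (hx₀D 0)
    rw [accPt_principal_iff_clusterPt, ← mem_closure_iff_clusterPt] at hacc
    exact closure_mono (fun x hx => hsub 0 x hx.1 hx.2) hacc
  refine ⟨?_, ⋃ n, D n, ?_, mem_iUnion.2 ⟨0, hx₀D 0⟩, ⟨⟨x₀, mem_iUnion.2 ⟨0, hx₀D 0⟩⟩, ?_⟩, ?_, ?_⟩
  · have happ : ∀ n : ℕ, ∃ z ∈ SolX, dist x₀ z < 1 / ((n : ℝ) + 1) := fun n =>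
      Metric.mem_closure_iff.1 hx₀cl _ Nat.one_div_pos_of_nat
    choose z hz hdist using happ
    choose v hv hvn hvr using hz
    have hzlim : Tendsto z atTop (𝓝 x₀) := by
      rw [tendsto_iff_dist_tendsto_zero]
      refine squeeze_zero (fun _ => dist_nonneg) (fun n => ?_)
        tendsto_one_div_add_atTop_nhds_zero_nat
      rw [dist_comm]
      exact (hdist n).le
    refine ⟨fun n => (z n).1, v, fun n => ⟨hv n, hvn n⟩, (hzlim.fst_nhds :), ?_⟩
    have hlim : Tendsto (fun n => 2 * ‖(z n).2‖) atTop (𝓝 0) := by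
      simpa [hx₀] using hzlim.snd_nhds.norm.const_mul 2
    exact squeeze_zero (fun n => HalfLinear.normE_nonneg _)
      (fun n => HalfLinear.normE_le_of_reprE (hvr n)) hlim
  · refine iUnion_subset fun n x hx => ?_
    by_cases h : x = x₀
    · exact h ▸ hx₀cl
    · exact subset_closure (hsub n x hx h)
  · exact isPreconnected_iUnion ⟨x₀, mem_iInter.2 hx₀D⟩ fun n => (hDc n).isPreconnected
  · intro hb
    obtain ⟨M, hM⟩ := isBounded_iff_forall_norm_le.1 hb
    obtain ⟨n, hn⟩ := exists_nat_gt M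
    obtain ⟨x, hx, hxR⟩ := hDfar n
    have := hM x (mem_iUnion.2 ⟨n, hx⟩)
    linarith [abs_nonneg (lamk / (r * f0))]
  · refine iUnion_subset fun n x hx => ?_
    rcases hDsol n x hx with h | ⟨v, _, _, h3, h4⟩
    · exact .inr h
    · exact .inl ⟨v, h3, h4⟩
end
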